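/- arXiv:1611.09018 — 5 statements merged into one kernel-verified Lean document; each statement's English description precedes it below -/
import Mathlib

section
/- For every n ≥ 1, the polynomial identity Σ_{σ ∈ ISF_n} x^{ris12(σ)} = x^n · Π_{k=1}^{n} (x+3k−2) holds in ℤ[x]. -/
/-- `SF n`: binary-shrub-forest permutations of size `n`, modeled as permutations of
`Fin (3*n)` (0-based; position `p` corresponds to 1-based position `p+1`):
for every `0 ≤ i ≤ n-1`, `σ(3i+1) < σ(3i+2)` and `σ(3i+1) < σ(3i+3)` (1-based). -/
def SF (n : ℕ) : Finset (Equiv.Perm (Fin (3*n))) :=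
  Finset.univ.filter fun σ =>
    ∀ i < n, ∃ h : 3*i+2 < 3*n,
      σ ⟨3*i, by omega⟩ < σ ⟨3*i+1, by omega⟩ ∧ σ ⟨3*i, by omega⟩ < σ ⟨3*i+2, h⟩

/-- `ISF n`: those `σ ∈ SF n` with additionally `σ(3i) < σ(3i+1)` for `1 ≤ i ≤ n-1`
(1-based positions; 0-based: `σ(3j+2) < σ(3j+3)` for `0 ≤ j ≤ n-2`). -/
def ISF (n : ℕ) : Finset (Equiv.Perm (Fin (3*n))) :=
  (SF n).filter fun σ =>
    ∀ j < n - 1, ∃ h : 3*j+3 < 3*n, σ ⟨3*j+2, by omega⟩ < σ ⟨3*j+3, h⟩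

/-- `ris12 σ` = number of 1-based positions `j ∈ {1,…,3n-1}` with `σ(j) < σ(j+1)`
and `3 ∤ j`; 0-based position `p` corresponds to `j = p+1`. -/
def ris12 {n : ℕ} (σ : Equiv.Perm (Fin (3*n))) : ℕ :=
  ((Finset.range (3*n)).filter fun p =>
    (p + 1) % 3 ≠ 0 ∧ ∃ h : p + 1 < 3*n, σ ⟨p, by omega⟩ < σ ⟨p+1, h⟩).card

/-- The permutation of `Fin (m + 1)` sending `0` to `v` and whose remaining values are
order-isomorphic to those of `τ`. -/
def consPerm {m : ℕ} (v : Fin (m + 1)) (τ : Equiv.Perm (Fin m)) : Equiv.Perm (Fin (m + 1)) :=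
  (finSuccEquiv' 0).trans ((Equiv.optionCongr τ).trans (finSuccEquiv' v).symm)

lemma consPerm_zero {m : ℕ} (v : Fin (m + 1)) (τ : Equiv.Perm (Fin m)) :
    consPerm v τ 0 = v := by
  simp [consPerm]

lemma consPerm_succ {m : ℕ} (v : Fin (m + 1)) (τ : Equiv.Perm (Fin m)) (i : Fin m) :
    consPerm v τ i.succ = v.succAbove (τ i) := by
  have h : finSuccEquiv' (0 : Fin (m + 1)) i.succ = some i := by
    rw [← Fin.succAbove_zero_apply, finSuccEquiv'_succAbove]
  simp [consPerm, h]

lemma consPerm_injective {m : ℕ} :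
    Function.Injective fun p : Fin (m + 1) × Equiv.Perm (Fin m) => consPerm p.1 p.2 := by
  rintro ⟨v, τ⟩ ⟨w, ρ⟩ h
  dsimp only at h
  have h0 : v = w := by rw [← consPerm_zero v τ, h, consPerm_zero]
  subst h0
  congr 1
  ext i : 1
  have h1 := consPerm_succ v τ i
  rw [h, consPerm_succ] at h1
  exact (Fin.succAbove_right_injective h1).symm

lemma exists_consPerm {m : ℕ} (σ : Equiv.Perm (Fin (m + 1))) :
    ∃ v τ, consPerm v τ = σ := by
  have hb := (Fintype.bijective_iff_injective_and_card
    fun p : Fin (m + 1) × Equiv.Perm (Fin m) => consPerm p.1 p.2).2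
    ⟨consPerm_injective, by simp [Fintype.card_perm, Nat.factorial_succ]⟩
  obtain ⟨⟨v, τ⟩, h⟩ := hb.2 σ
  exact ⟨v, τ, h⟩

/-- The values of a permutation of `Fin m` as a function on natural numbers, zero outside the
range. -/
def permVal {m : ℕ} (σ : Equiv.Perm (Fin m)) (p : ℕ) : ℕ :=
  if h : p < m then (σ ⟨p, h⟩ : ℕ) else 0

lemma permVal_of_lt {m : ℕ} (σ : Equiv.Perm (Fin m)) {p : ℕ} (h : p < m) :
    permVal σ p = σ ⟨p, h⟩ := dif_pos h

lemma permVal_consPerm_zero {m : ℕ} (v : Fin (m + 1)) (τ : Equiv.Perm (Fin m)) :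
    permVal (consPerm v τ) 0 = v := by
  rw [permVal_of_lt _ (Nat.succ_pos m)]
  exact congrArg Fin.val (consPerm_zero v τ)

lemma permVal_consPerm_succ {m : ℕ} (v : Fin (m + 1)) (τ : Equiv.Perm (Fin m)) {p : ℕ}
    (h : p < m) :
    permVal (consPerm v τ) (p + 1) =
      if permVal τ p < v then permVal τ p else permVal τ p + 1 := by
  rw [permVal_of_lt _ (Nat.succ_lt_succ h), permVal_of_lt _ h]
  have := congrArg Fin.val (consPerm_succ v τ ⟨p, h⟩)
  rw [Fin.succ_mk] at this
  rw [this, Fin.succAbove]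
  simp only [Fin.lt_def, Fin.val_castSucc]
  split_ifs <;> simp

/-- A permutation whose value at `0` is minimal starts with the value `0`. -/
lemma permVal_zero_eq_zero {m : ℕ} (σ : Equiv.Perm (Fin (m + 1)))
    (h : ∀ p < m + 1, permVal σ 0 ≤ permVal σ p) : permVal σ 0 = 0 := by
  have h1 := h (σ.symm 0) (σ.symm 0).isLt
  rw [permVal_of_lt σ (σ.symm 0).isLt] at h1
  simpa using h1

lemma mem_ISF_iff {n : ℕ} (σ : Equiv.Perm (Fin (3 * n))) :
    σ ∈ ISF n ↔
      (∀ i < n, permVal σ (3 * i) < permVal σ (3 * i + 1) ∧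
        permVal σ (3 * i) < permVal σ (3 * i + 2)) ∧
      ∀ j, j + 1 < n → permVal σ (3 * j + 2) < permVal σ (3 * j + 3) := by
  simp only [ISF, SF, Finset.mem_filter, Finset.mem_univ, true_and]
  refine and_congr (forall₂_congr fun i hi => ?_) (forall_congr' fun j => ?_)
  · rw [permVal_of_lt σ (show 3 * i < 3 * n by omega),
      permVal_of_lt σ (show 3 * i + 1 < 3 * n by omega),
      permVal_of_lt σ (show 3 * i + 2 < 3 * n by omega)]
    exact ⟨fun ⟨_, h⟩ => h, fun h => ⟨by omega, h⟩⟩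
  · rw [Nat.lt_sub_iff_add_lt]
    refine forall_congr' fun hj => ?_
    rw [permVal_of_lt σ (show 3 * j + 2 < 3 * n by omega),
      permVal_of_lt σ (show 3 * j + 3 < 3 * n by omega)]
    exact ⟨fun ⟨_, h⟩ => h, fun h => ⟨by omega, h⟩⟩

lemma ris12_eq_sum {n : ℕ} (σ : Equiv.Perm (Fin (3 * n))) :
    ris12 σ = ∑ i ∈ Finset.range n,
      ((if permVal σ (3 * i) < permVal σ (3 * i + 1) then 1 else 0) +
        if permVal σ (3 * i + 1) < permVal σ (3 * i + 2) then 1 else 0) := by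
  have h : ris12 σ = ∑ p ∈ Finset.range (3 * n),
      if (p + 1) % 3 ≠ 0 ∧ permVal σ p < permVal σ (p + 1) then 1 else 0 := by
    rw [ris12, Finset.card_filter]
    refine Finset.sum_congr rfl fun p hp => ?_
    have hp' := Finset.mem_range.1 hp
    refine if_congr (and_congr_right fun h3 => ?_) rfl rfl
    have hp1 : p + 1 < 3 * n := by omega
    rw [permVal_of_lt σ hp', permVal_of_lt σ hp1]
    exact ⟨fun ⟨_, h⟩ => h, fun h => ⟨hp1, h⟩⟩
  rw [h]
  clear h
  generalize permVal σ = s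
  clear σ
  induction n with
  | zero => simp
  | succ k ih =>
    rw [Finset.sum_range_succ, ← ih, Nat.mul_succ, Finset.sum_range_succ, Finset.sum_range_succ,
      Finset.sum_range_succ]
    have h1 : (3 * k + 1) % 3 ≠ 0 := by omega
    have h2 : (3 * k + 1 + 1) % 3 ≠ 0 := by omega
    have h3 : (3 * k + 2 + 1) % 3 = 0 := by omega
    simp only [h1, h2, h3, ne_eq, not_true_eq_false, not_false_eq_true, true_and, false_and,
      if_false, add_zero, add_assoc, Nat.reduceAdd]

/-- The permutation obtained by prepending to `τ` a shrub whose root takes the least value, whose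
middle entry takes the value `b + 1`, and whose last entry takes the least remaining value. -/
def consShrub {n : ℕ} (b : Fin (3 * n + 2)) (τ : Equiv.Perm (Fin (3 * n))) :
    Equiv.Perm (Fin (3 * (n + 1))) :=
  consPerm (m := 3 * n + 2) 0 (consPerm (m := 3 * n + 1) b (consPerm 0 τ))

lemma consShrub_injective {n : ℕ} :
    Function.Injective fun p : Fin (3 * n + 2) × Equiv.Perm (Fin (3 * n)) =>
      consShrub p.1 p.2 := by
  rintro ⟨b, τ⟩ ⟨c, ρ⟩ h
  have h1 := @consPerm_injective (3 * n + 2) (_, _) (_, _) h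
  have h2 := @consPerm_injective (3 * n + 1) (_, _) (_, _) (Prod.ext_iff.1 h1).2
  have h3 := @consPerm_injective (3 * n) (_, _) (_, _) (Prod.ext_iff.1 h2).2
  exact Prod.ext (Prod.ext_iff.1 h2).1 (Prod.ext_iff.1 h3).2

section

variable {n : ℕ} (b : Fin (3 * n + 2)) (τ : Equiv.Perm (Fin (3 * n)))

lemma permVal_consShrub_zero : permVal (consShrub b τ) 0 = 0 :=
  permVal_consPerm_zero (m := 3 * n + 2) _ _

lemma permVal_consShrub_one : permVal (consShrub b τ) 1 = b + 1 := by
  have h := permVal_consPerm_succ (m := 3 * n + 2) 0 (consPerm (m := 3 * n + 1) b (consPerm 0 τ))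
    (show 0 < 3 * n + 2 by omega)
  rw [permVal_consPerm_zero] at h
  exact h

lemma permVal_consShrub_two :
    permVal (consShrub b τ) 2 = if (b : ℕ) = 0 then 2 else 1 := by
  have h := permVal_consPerm_succ (m := 3 * n + 2) 0 (consPerm (m := 3 * n + 1) b (consPerm 0 τ))
    (show 1 < 3 * n + 2 by omega)
  have h' := permVal_consPerm_succ (m := 3 * n + 1) b (consPerm 0 τ) (show 0 < 3 * n + 1 by omega)
  rw [permVal_consPerm_zero] at h'
  rw [zero_add] at h'
  rw [h'] at h
  refine h.trans ?_
  by_cases hb : (b : ℕ) = 0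
  · simp [hb]
  · simp [hb, Nat.pos_of_ne_zero hb]

lemma permVal_consShrub_add_three {p : ℕ} (hp : p < 3 * n) :
    permVal (consShrub b τ) (p + 3) =
      if permVal τ p + 1 < b then permVal τ p + 2 else permVal τ p + 3 := by
  have h1 := permVal_consPerm_succ (m := 3 * n + 2) 0
    (consPerm (m := 3 * n + 1) b (consPerm 0 τ)) (show p + 2 < 3 * n + 2 by omega)
  have h2 := permVal_consPerm_succ (m := 3 * n + 1) b (consPerm 0 τ)
    (show p + 1 < 3 * n + 1 by omega)
  have h3 := permVal_consPerm_succ 0 τ hp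
  simp only [Fin.val_zero, Nat.not_lt_zero, if_false] at h1 h3
  rw [h3] at h2
  rw [h2] at h1
  refine h1.trans ?_
  split_ifs <;> omega

lemma permVal_consShrub_lt_iff {p q : ℕ} (hp : p < 3 * n) (hq : q < 3 * n) :
    permVal (consShrub b τ) (p + 3) < permVal (consShrub b τ) (q + 3) ↔
      permVal τ p < permVal τ q := by
  rw [permVal_consShrub_add_three b τ hp, permVal_consShrub_add_three b τ hq]
  split_ifs <;> omega

lemma consShrub_mem_ISF_iff : consShrub b τ ∈ ISF (n + 1) ↔ τ ∈ ISF n := by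
  rw [mem_ISF_iff, mem_ISF_iff]
  constructor
  · rintro ⟨h1, h2⟩
    refine ⟨fun i hi => ?_, fun j hj => ?_⟩
    · have h := h1 (i + 1) (by omega)
      rwa [show 3 * (i + 1) = 3 * i + 3 by ring, show 3 * i + 3 + 1 = 3 * i + 1 + 3 by ring,
        show 3 * i + 3 + 2 = 3 * i + 2 + 3 by ring,
        permVal_consShrub_lt_iff b τ (by omega) (by omega),
        permVal_consShrub_lt_iff b τ (by omega) (by omega)] at h
    · have h := h2 (j + 1) (by omega)
      rwa [show 3 * (j + 1) + 2 = 3 * j + 2 + 3 by ring,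
        show 3 * (j + 1) + 3 = 3 * j + 3 + 3 by ring,
        permVal_consShrub_lt_iff b τ (by omega) (by omega)] at h
  · rintro ⟨h1, h2⟩
    refine ⟨fun i hi => ?_, fun j hj => ?_⟩
    · rcases i with _ | i
      · simp only [mul_zero, zero_add, permVal_consShrub_zero, permVal_consShrub_one,
          permVal_consShrub_two]
        split_ifs <;> omega
      · rw [show 3 * (i + 1) = 3 * i + 3 by ring, show 3 * i + 3 + 1 = 3 * i + 1 + 3 by ring,
          show 3 * i + 3 + 2 = 3 * i + 2 + 3 by ring,
          permVal_consShrub_lt_iff b τ (by omega) (by omega),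
          permVal_consShrub_lt_iff b τ (by omega) (by omega)]
        exact h1 i (by omega)
    · rcases j with _ | j
      · have h := permVal_consShrub_add_three b τ (show 0 < 3 * n by omega)
        simp only [mul_zero, zero_add, permVal_consShrub_two] at h ⊢
        rw [h]
        split_ifs <;> omega
      · rw [show 3 * (j + 1) + 2 = 3 * j + 2 + 3 by ring,
          show 3 * (j + 1) + 3 = 3 * j + 3 + 3 by ring,
          permVal_consShrub_lt_iff b τ (by omega) (by omega)]
        exact h2 j (by omega)

lemma ris12_consShrub :
    ris12 (consShrub b τ) = (1 + if (b : ℕ) = 0 then 1 else 0) + ris12 τ := by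
  rw [ris12_eq_sum, ris12_eq_sum, Finset.sum_range_succ', add_comm]
  congr 1
  · simp only [mul_zero, zero_add, permVal_consShrub_zero, permVal_consShrub_one,
      permVal_consShrub_two]
    split_ifs <;> omega
  · refine Finset.sum_congr rfl fun i hi => ?_
    have hi' := Finset.mem_range.1 hi
    rw [show 3 * (i + 1) = 3 * i + 3 by ring, show 3 * i + 3 + 1 = 3 * i + 1 + 3 by ring,
      show 3 * i + 3 + 2 = 3 * i + 2 + 3 by ring]
    simp only [permVal_consShrub_lt_iff b τ (show 3 * i < 3 * n by omega)
      (show 3 * i + 1 < 3 * n by omega), permVal_consShrub_lt_iff b τ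
      (show 3 * i + 1 < 3 * n by omega) (show 3 * i + 2 < 3 * n by omega)]

end

/-- In an element of `ISF n`, the root of each shrub is at most every later value. -/
lemma permVal_le_of_mem_ISF {n : ℕ} {σ : Equiv.Perm (Fin (3 * n))} (hσ : σ ∈ ISF n) {i p : ℕ}
    (hip : 3 * i ≤ p) (hp : p < 3 * n) : permVal σ (3 * i) ≤ permVal σ p := by
  rw [mem_ISF_iff] at hσ
  obtain ⟨h1, h2⟩ := hσ
  have key : ∀ k, i + k < n → permVal σ (3 * i) ≤ permVal σ (3 * (i + k)) := by
    intro k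
    induction k with
    | zero => intro _; rfl
    | succ k ih =>
      intro hk
      have := ih (by omega)
      have := (h1 (i + k) (by omega)).2
      have := h2 (i + k) (by omega)
      rw [show 3 * (i + (k + 1)) = 3 * (i + k) + 3 by ring]
      omega
  have hk := key (p / 3 - i) (by omega)
  rw [show i + (p / 3 - i) = p / 3 by omega] at hk
  have h3 := h1 (p / 3) (by omega)
  obtain h | h | h : p = 3 * (p / 3) ∨ p = 3 * (p / 3) + 1 ∨ p = 3 * (p / 3) + 2 := by omega
  all_goals rw [h]; omega

lemma exists_consShrub {n : ℕ} {σ : Equiv.Perm (Fin (3 * (n + 1)))} (hσ : σ ∈ ISF (n + 1)) :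
    ∃ b, ∃ τ ∈ ISF n, consShrub b τ = σ := by
  obtain ⟨v, σ₁, rfl⟩ := exists_consPerm (m := 3 * n + 2) σ
  obtain ⟨b, σ₂, rfl⟩ := exists_consPerm (m := 3 * n + 1) σ₁
  obtain ⟨c, τ, rfl⟩ := exists_consPerm σ₂
  have hv : v = 0 := by
    have h := permVal_zero_eq_zero (m := 3 * n + 2) _
      fun p hp => permVal_le_of_mem_ISF hσ (i := 0) (Nat.zero_le p) hp
    rw [permVal_consPerm_zero] at h
    exact Fin.ext h
  subst hv
  have hc : c = 0 := by
    have h := permVal_zero_eq_zero (consPerm c τ) fun p hp => by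
      rcases p with _ | p
      · rfl
      have hlt : permVal (consPerm (m := 3 * n + 2) 0 (consPerm (m := 3 * n + 1) b
          (consPerm c τ))) 2 < permVal (consPerm (m := 3 * n + 2) 0 (consPerm (m := 3 * n + 1) b
          (consPerm c τ))) (p + 3) :=
        (((mem_ISF_iff _).1 hσ).2 0 (by omega)).trans_le
          (permVal_le_of_mem_ISF hσ (i := 1) (by omega) (by omega))
      rw [permVal_consPerm_succ _ _ (show 1 < 3 * n + 2 by omega),
        permVal_consPerm_succ _ _ (show p + 2 < 3 * n + 2 by omega),
        permVal_consPerm_succ _ _ (show p + 1 < 3 * n + 1 by omega),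
        permVal_consPerm_succ _ _ (show 0 < 3 * n + 1 by omega)] at hlt
      simp only [Fin.val_zero, Nat.not_lt_zero, if_false] at hlt
      split_ifs at hlt <;> omega
    rw [permVal_consPerm_zero] at h
    exact Fin.ext h
  subst hc
  exact ⟨b, τ, (consShrub_mem_ISF_iff b τ).1 hσ, rfl⟩

lemma sum_ris12_succ (n : ℕ) :
    ∑ σ ∈ ISF (n + 1), (Polynomial.X : Polynomial ℤ) ^ ris12 σ =
      Polynomial.X * (Polynomial.X + Polynomial.C (3 * ((n + 1 : ℕ) : ℤ) - 2)) *
        ∑ τ ∈ ISF n, (Polynomial.X : Polynomial ℤ) ^ ris12 τ := by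
  have h : ∑ σ ∈ ISF (n + 1), (Polynomial.X : Polynomial ℤ) ^ ris12 σ =
      ∑ p ∈ (Finset.univ : Finset (Fin (3 * n + 2))) ×ˢ ISF n,
        (Polynomial.X : Polynomial ℤ) ^ (1 + if (p.1 : ℕ) = 0 then 1 else 0) *
          Polynomial.X ^ ris12 p.2 := by
    symm
    refine Finset.sum_nbij (fun p => consShrub p.1 p.2) ?_ consShrub_injective.injOn ?_ ?_
    · rintro ⟨b, τ⟩ hp
      exact (consShrub_mem_ISF_iff b τ).2 (Finset.mem_product.1 hp).2
    · intro σ hσ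
      obtain ⟨b, τ, hτ, rfl⟩ := exists_consShrub hσ
      exact ⟨(b, τ), by simpa using hτ, rfl⟩
    · rintro ⟨b, τ⟩ _
      rw [ris12_consShrub, pow_add _ _ (ris12 τ)]
  rw [h, Finset.sum_product]
  refine (Finset.sum_mul_sum _ _
    (fun b : Fin (3 * n + 2) => (Polynomial.X : Polynomial ℤ) ^ (1 + if (b : ℕ) = 0 then 1 else 0))
    fun τ => Polynomial.X ^ ris12 τ).symm.trans ?_
  congr 1
  rw [Fin.sum_univ_succ]
  simp
  ring

theorem sum_ris12 (n : ℕ) (hn : 1 ≤ n) :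
    ∑ σ ∈ ISF n, (Polynomial.X : Polynomial ℤ) ^ ris12 σ =
      Polynomial.X ^ n *
        ∏ k ∈ Finset.Icc 1 n, (Polynomial.X + Polynomial.C (3 * (k : ℤ) - 2)) := by
  clear hn
  induction n with
  | zero => simp [ISF, SF, ris12]
  | succ n ih =>
    rw [sum_ris12_succ, ih, Finset.prod_Icc_succ_top (by omega)]
    ring
end

section
/- In the ring ℚ[x][[t]], the following identity holds: (1 + Σ_{n≥1} (t^{3n}/(3n)!) · Σ_{σ ∈ SF_n} x^{risT(σ)}) · (1 − Σ_{n≥1} (t^{3n}/(3n)!) (x−1)^{n−1} · ITF_n) = 1. Equivalently, the exponential generating function of the statistic risT over binary-shrub-forest permutations equals 1/(1 − Σ_{n≥1} (t^{3n}/(3n)!)(x−1)^{n−1} ITF_n). -/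
/-- 0-based shrub index `j` is a total rise (1-based rise index `i = j+1`):
`max{σ(3i-2),σ(3i-1),σ(3i)} < min{σ(3i+1),σ(3i+2),σ(3i+3)}` in 1-based terms. -/
def totalRise (n : ℕ) (σ : Equiv.Perm (Fin (3*n))) (j : ℕ) : Prop :=
  ∃ h : 3*j+5 < 3*n,
    max (max (σ ⟨3*j, by omega⟩) (σ ⟨3*j+1, by omega⟩)) (σ ⟨3*j+2, by omega⟩) <
    min (min (σ ⟨3*j+3, by omega⟩) (σ ⟨3*j+4, by omega⟩)) (σ ⟨3*j+5, h⟩)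

instance (n : ℕ) (σ : Equiv.Perm (Fin (3*n))) : DecidablePred (totalRise n σ) :=
  fun _ => by unfold totalRise; infer_instance

/-- `risT σ`: the number of total rises of `σ`. -/
def risT (n : ℕ) (σ : Equiv.Perm (Fin (3*n))) : ℕ :=
  ((Finset.range n).filter (totalRise n σ)).card

/-- `ITF n`: the number of `σ ∈ SF n` for which every `i ∈ {1,…,n-1}` is a total rise. -/
def ITF (n : ℕ) : ℕ := ((SF n).filter fun σ => ∀ j < n - 1, totalRise n σ j).card

/-- The EGF `1 + Σ_{n≥1} (t^(3n)/(3n)!) Σ_{σ ∈ SF n} x^(risT σ)` in `ℚ[x][[t]]`. -/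
noncomputable def RTser : PowerSeries (Polynomial ℚ) :=
  PowerSeries.mk fun m =>
    if m = 0 then 1
    else if m % 3 = 0 then
      Polynomial.C ((m.factorial : ℚ)⁻¹) * ∑ σ ∈ SF (m / 3), Polynomial.X ^ risT (m / 3) σ
    else 0

/-- The series `1 - Σ_{n≥1} (t^(3n)/(3n)!) (x-1)^(n-1) ⋅ ITF n` in `ℚ[x][[t]]`. -/
noncomputable def GTser : PowerSeries (Polynomial ℚ) :=
  PowerSeries.mk fun m =>
    if m = 0 then 1
    else if m % 3 = 0 then
      -(Polynomial.C ((m.factorial : ℚ)⁻¹) * (Polynomial.X - 1) ^ (m / 3 - 1) *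
        (ITF (m / 3) : Polynomial ℚ))
    else 0

section ShuffleDecomposition

open Finset Polynomial

/-- The one-line notation of `σ`, extended by `0` to all of `ℕ`. -/
def oneLine {N : ℕ} (σ : Equiv.Perm (Fin N)) (p : ℕ) : ℕ :=
  if h : p < N then (σ ⟨p, h⟩ : ℕ) else 0

theorem mem_SF_iff {n : ℕ} {σ : Equiv.Perm (Fin (3 * n))} :
    σ ∈ SF n ↔ ∀ i < n, oneLine σ (3 * i) < oneLine σ (3 * i + 1) ∧
      oneLine σ (3 * i) < oneLine σ (3 * i + 2) := by
  simp only [SF, mem_filter, mem_univ, true_and]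
  refine forall₂_congr fun i hi => ?_
  have h0 : 3 * i < 3 * n := by omega
  have h1 : 3 * i + 1 < 3 * n := by omega
  have h2 : 3 * i + 2 < 3 * n := by omega
  simp [oneLine, h0, h1, h2]

theorem totalRise_iff {n : ℕ} {σ : Equiv.Perm (Fin (3 * n))} {j : ℕ} :
    totalRise n σ j ↔ j + 1 < n ∧
      ∀ u < 3, ∀ v < 3, oneLine σ (3 * j + u) < oneLine σ (3 * j + 3 + v) := by
  by_cases hj : j + 1 < n
  · have h0 : 3 * j < 3 * n := by omega
    have h1 : 3 * j + 1 < 3 * n := by omega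
    have h2 : 3 * j + 2 < 3 * n := by omega
    have h3 : 3 * j + 3 < 3 * n := by omega
    have h4 : 3 * j + 3 + 1 < 3 * n := by omega
    have h5 : 3 * j + 3 + 2 < 3 * n := by omega
    simp only [totalRise, max_lt_iff, lt_min_iff, Nat.forall_lt_succ_right, Nat.not_lt_zero,
      IsEmpty.forall_iff, implies_true, true_and, oneLine, hj, add_zero, h0, h1, h2, h3, h4, h5,
      dite_true, Fin.lt_def]
    tauto
  · simp only [totalRise, hj, false_and, iff_false]
    rintro ⟨h, -⟩
    omega

/-- Arrange the elements of `s` in the pattern `σ₁`, followed by those of `sᶜ` in the pattern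
`σ₂`. -/
def shuffle {a b N : ℕ} (h : a + b = N) (s : {s : Finset (Fin N) // #s = a})
    (σ₁ : Equiv.Perm (Fin a)) (σ₂ : Equiv.Perm (Fin b)) : Equiv.Perm (Fin N) :=
  (finSumFinEquiv.trans (finCongr h)).symm.trans <|
    (Equiv.Perm.sumCongr σ₁ σ₂).trans <|
      finSumEquivOfFinset (s := s.1) (m := a) (n := b) s.2
        (by rw [card_compl, s.2, Fintype.card_fin]; omega)

theorem oneLine_shuffle {a b N : ℕ} (h : a + b = N) (s : {s : Finset (Fin N) // #s = a})
    (σ₁ : Equiv.Perm (Fin a)) (σ₂ : Equiv.Perm (Fin b)) (i : Fin a) :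
    oneLine (shuffle h s σ₁ σ₂) i = s.1.orderEmbOfFin s.2 (σ₁ i) := by
  subst h
  have hi : finSumFinEquiv.symm ⟨i, by omega⟩ = (Sum.inl i : Fin a ⊕ Fin b) :=
    (Equiv.symm_apply_eq _).2 rfl
  rw [oneLine, dif_pos (by omega)]
  simp [shuffle, hi]

theorem oneLine_shuffle_add {a b N : ℕ} (h : a + b = N) (s : {s : Finset (Fin N) // #s = a})
    (σ₁ : Equiv.Perm (Fin a)) (σ₂ : Equiv.Perm (Fin b)) (i : Fin b) :
    oneLine (shuffle h s σ₁ σ₂) (a + i) =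
      s.1ᶜ.orderEmbOfFin (by rw [card_compl, s.2, Fintype.card_fin]; omega) (σ₂ i) := by
  subst h
  have hi : finSumFinEquiv.symm ⟨a + i, by omega⟩ = (Sum.inr i : Fin a ⊕ Fin b) :=
    (Equiv.symm_apply_eq _).2 rfl
  rw [oneLine, dif_pos (by omega)]
  simp [shuffle, hi]

theorem oneLine_shuffle_lt_iff {a b N : ℕ} (h : a + b = N) (s : {s : Finset (Fin N) // #s = a})
    (σ₁ : Equiv.Perm (Fin a)) (σ₂ : Equiv.Perm (Fin b)) {p q : ℕ} (hp : p < a) (hq : q < a) :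
    oneLine (shuffle h s σ₁ σ₂) p < oneLine (shuffle h s σ₁ σ₂) q ↔
      oneLine σ₁ p < oneLine σ₁ q := by
  have h₁ := oneLine_shuffle h s σ₁ σ₂ ⟨p, hp⟩
  have h₂ := oneLine_shuffle h s σ₁ σ₂ ⟨q, hq⟩
  dsimp only at h₁ h₂
  rw [h₁, h₂]
  simp [oneLine, hp, hq]

theorem oneLine_shuffle_add_lt_iff {a b N : ℕ} (h : a + b = N)
    (s : {s : Finset (Fin N) // #s = a}) (σ₁ : Equiv.Perm (Fin a)) (σ₂ : Equiv.Perm (Fin b))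
    {p q : ℕ} (hp : p < b) (hq : q < b) :
    oneLine (shuffle h s σ₁ σ₂) (a + p) < oneLine (shuffle h s σ₁ σ₂) (a + q) ↔
      oneLine σ₂ p < oneLine σ₂ q := by
  have h₁ := oneLine_shuffle_add h s σ₁ σ₂ ⟨p, hp⟩
  have h₂ := oneLine_shuffle_add h s σ₁ σ₂ ⟨q, hq⟩
  dsimp only at h₁ h₂
  rw [h₁, h₂]
  simp [oneLine, hp, hq]

theorem shuffle_surjective {a b N : ℕ} (h : a + b = N) :
    Function.Surjective fun x : {s : Finset (Fin N) // #s = a} ×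
      Equiv.Perm (Fin a) × Equiv.Perm (Fin b) => shuffle h x.1 x.2.1 x.2.2 := by
  intro σ
  let e : Fin a ⊕ Fin b ≃ Fin N := finSumFinEquiv.trans (finCongr h)
  let s : Finset (Fin N) := univ.map ⟨fun i : Fin a => σ (e (Sum.inl i)),
    (σ.injective.comp e.injective).comp Sum.inl_injective⟩
  have hs : #s = a := by simp [s]
  let f := finSumEquivOfFinset (s := s) (m := a) (n := b) hs
    (by rw [card_compl, hs, Fintype.card_fin]; omega)
  let τ : Equiv.Perm (Fin a ⊕ Fin b) := (e.trans σ).trans f.symm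
  have hτ : Set.MapsTo τ (Set.range Sum.inl) (Set.range Sum.inl) := by
    rintro _ ⟨i, rfl⟩
    have hi : σ (e (Sum.inl i)) ∈ s := mem_map_of_mem _ (mem_univ i)
    obtain ⟨j, hj⟩ : σ (e (Sum.inl i)) ∈ Set.range (s.orderEmbOfFin hs) := by
      rw [range_orderEmbOfFin]
      exact hi
    exact ⟨j, ((Equiv.symm_apply_eq f).2 hj.symm).symm⟩
  obtain ⟨⟨σ₁, σ₂⟩, hσ⟩ := Equiv.Perm.mem_sumCongrHom_range_of_perm_mapsTo_inl hτ
  refine ⟨⟨⟨s, hs⟩, σ₁, σ₂⟩, ?_⟩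
  change (e.symm.trans (Equiv.Perm.sumCongrHom _ _ (σ₁, σ₂))).trans f = σ
  rw [hσ]
  ext x
  simp [τ]

theorem shuffle_bijective {a b N : ℕ} (h : a + b = N) :
    Function.Bijective fun x : {s : Finset (Fin N) // #s = a} ×
      Equiv.Perm (Fin a) × Equiv.Perm (Fin b) => shuffle h x.1 x.2.1 x.2.2 := by
  refine (Fintype.bijective_iff_surjective_and_card _).2 ⟨shuffle_surjective h, ?_⟩
  subst h
  simp only [Fintype.card_prod, Fintype.card_finset_len, Fintype.card_perm, Fintype.card_fin]
  rw [← mul_assoc]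
  simpa using Nat.choose_mul_factorial_mul_factorial (Nat.le_add_right a b)

theorem shuffle_mem_SF_iff {j k N : ℕ} (h : 3 * j + 3 * k = 3 * N)
    (s : {s : Finset (Fin (3 * N)) // #s = 3 * j})
    (σ₁ : Equiv.Perm (Fin (3 * j))) (σ₂ : Equiv.Perm (Fin (3 * k))) :
    shuffle h s σ₁ σ₂ ∈ SF N ↔ σ₁ ∈ SF j ∧ σ₂ ∈ SF k := by
  have hN : N = j + k := by omega
  have key₁ : ∀ i < j, ∀ u < 3, oneLine (shuffle h s σ₁ σ₂) (3 * i) <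
      oneLine (shuffle h s σ₁ σ₂) (3 * i + u) ↔ oneLine σ₁ (3 * i) < oneLine σ₁ (3 * i + u) :=
    fun i hi u hu => oneLine_shuffle_lt_iff h s σ₁ σ₂ (by omega) (by omega)
  have key₂ : ∀ i < k, ∀ u < 3, oneLine (shuffle h s σ₁ σ₂) (3 * (j + i)) <
      oneLine (shuffle h s σ₁ σ₂) (3 * (j + i) + u) ↔
        oneLine σ₂ (3 * i) < oneLine σ₂ (3 * i + u) := fun i hi u hu => by
    rw [mul_add, add_assoc]
    exact oneLine_shuffle_add_lt_iff h s σ₁ σ₂ (by omega) (by omega)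
  simp only [mem_SF_iff]
  refine ⟨fun H => ⟨fun i hi => ?_, fun i hi => ?_⟩, fun ⟨H₁, H₂⟩ i hi => ?_⟩
  · rw [← key₁ i hi 1 (by omega), ← key₁ i hi 2 (by omega)]
    exact H i (by omega)
  · rw [← key₂ i hi 1 (by omega), ← key₂ i hi 2 (by omega)]
    exact H (j + i) (by omega)
  · rcases lt_or_ge i j with hij | hij
    · rw [key₁ i hij 1 (by omega), key₁ i hij 2 (by omega)]
      exact H₁ i hij
    · obtain ⟨i, rfl⟩ := Nat.exists_eq_add_of_le hij
      rw [key₂ i (by omega) 1 (by omega), key₂ i (by omega) 2 (by omega)]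
      exact H₂ i (by omega)

theorem totalRise_shuffle_iff {j k N : ℕ} (h : 3 * j + 3 * k = 3 * N)
    (s : {s : Finset (Fin (3 * N)) // #s = 3 * j})
    (σ₁ : Equiv.Perm (Fin (3 * j))) (σ₂ : Equiv.Perm (Fin (3 * k))) {i : ℕ} (hi : i + 1 < j) :
    totalRise N (shuffle h s σ₁ σ₂) i ↔ totalRise j σ₁ i := by
  rw [totalRise_iff, totalRise_iff]
  refine and_congr (by omega) <| forall₂_congr fun u hu => forall₂_congr fun v hv => ?_
  exact oneLine_shuffle_lt_iff h s σ₁ σ₂ (by omega) (by omega)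

theorem totalRise_shuffle_add_iff {j k N : ℕ} (h : 3 * j + 3 * k = 3 * N)
    (s : {s : Finset (Fin (3 * N)) // #s = 3 * j})
    (σ₁ : Equiv.Perm (Fin (3 * j))) (σ₂ : Equiv.Perm (Fin (3 * k))) (i : ℕ) :
    totalRise N (shuffle h s σ₁ σ₂) (j + i) ↔ totalRise k σ₂ i := by
  rw [totalRise_iff, totalRise_iff, show j + i + 1 < N ↔ i + 1 < k by omega]
  refine and_congr_right fun hi => forall₂_congr fun u hu => forall₂_congr fun v hv => ?_
  rw [show 3 * (j + i) + u = 3 * j + (3 * i + u) by ring,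
    show 3 * (j + i) + 3 + v = 3 * j + (3 * i + 3 + v) by ring]
  exact oneLine_shuffle_add_lt_iff h s σ₁ σ₂ (by omega) (by omega)

/-- The distribution of `risT` on `SF n`. -/
noncomputable def risPoly (n : ℕ) : ℚ[X] := ∑ σ ∈ SF n, X ^ risT n σ

/-- The sum over those `σ ∈ SF n` that rise at `0, …, m - 1` of `X` to the number of total rises
at or after `l`. -/
noncomputable def tailRisPoly (n m l : ℕ) : ℚ[X] :=
  ∑ σ ∈ SF n with ∀ i < m, totalRise n σ i, X ^ #{i ∈ Ico l n | totalRise n σ i}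

theorem tailRisPoly_eq (n m : ℕ) :
    tailRisPoly n m m = tailRisPoly n m (m + 1) + (X - 1) * tailRisPoly n (m + 1) (m + 1) := by
  simp only [tailRisPoly, sum_filter, mul_sum, ← sum_add_distrib, Nat.forall_lt_succ_right]
  refine sum_congr rfl fun σ _ => ?_
  by_cases hm : ∀ i < m, totalRise n σ i
  · by_cases hr : totalRise n σ m
    · have hmn : m < n := by have := (totalRise_iff.1 hr).1; omega
      rw [← insert_Ico_add_one_left_eq_Ico hmn, filter_insert, if_pos hr, card_insert_of_notMem
        (by simp)]
      rw [if_pos hm, if_pos hm, if_pos ⟨hm, hr⟩]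
      ring
    · have : ({i ∈ Ico m n | totalRise n σ i} : Finset ℕ) =
          {i ∈ Ico (m + 1) n | totalRise n σ i} := by
        ext i
        simp only [mem_filter, mem_Ico]
        refine ⟨fun ⟨⟨h₁, h₂⟩, h₃⟩ => ⟨⟨?_, h₂⟩, h₃⟩, fun ⟨⟨h₁, h₂⟩, h₃⟩ => ⟨⟨by omega, h₂⟩, h₃⟩⟩
        exact lt_of_le_of_ne h₁ fun h => hr (h ▸ h₃)
      simp [hr, this]
  · simp [hm]

theorem risPoly_eq_sum_add (n m : ℕ) :
    risPoly n = ∑ i ∈ range m, (X - 1) ^ i * tailRisPoly n i (i + 1) +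
      (X - 1) ^ m * tailRisPoly n m m := by
  induction m with
  | zero => simp [risPoly, tailRisPoly, risT]
  | succ m ih => rw [ih, sum_range_succ, tailRisPoly_eq]; ring

theorem tailRisPoly_self {n : ℕ} (hn : n ≠ 0) (l : ℕ) : tailRisPoly n n l = 0 := by
  rw [tailRisPoly, filter_false_of_mem, sum_empty]
  intro σ _ H
  have := (totalRise_iff.1 (H (n - 1) (by omega))).1
  omega

theorem risPoly_eq_sum {n : ℕ} (hn : n ≠ 0) :
    risPoly n = ∑ i ∈ range n, (X - 1) ^ i * tailRisPoly n i (i + 1) := by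
  rw [risPoly_eq_sum_add n n, tailRisPoly_self hn, mul_zero, add_zero]

theorem tailRisPoly_shuffle (m k : ℕ) :
    tailRisPoly (m + 1 + k) m (m + 1) =
      ((3 * (m + 1 + k)).choose (3 * (m + 1)) : ℚ[X]) * ITF (m + 1) * risPoly k := by
  have h : 3 * (m + 1) + 3 * k = 3 * (m + 1 + k) := by ring
  have hexp (s : {s : Finset (Fin (3 * (m + 1 + k))) // #s = 3 * (m + 1)})
      (σ₁ : Equiv.Perm (Fin (3 * (m + 1)))) (σ₂ : Equiv.Perm (Fin (3 * k))) :
      #{i ∈ Ico (m + 1) (m + 1 + k) | totalRise _ (shuffle h s σ₁ σ₂) i} = risT k σ₂ := by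
    refine Eq.trans (congrArg card ?_) (card_map (addLeftEmbedding (m + 1)))
    ext i
    simp only [mem_filter, mem_Ico, mem_map, mem_range, addLeftEmbedding_apply]
    constructor
    · rintro ⟨⟨h₁, h₂⟩, h₃⟩
      obtain ⟨i, rfl⟩ := Nat.exists_eq_add_of_le h₁
      exact ⟨i, ⟨by omega, (totalRise_shuffle_add_iff h s σ₁ σ₂ i).1 h₃⟩, rfl⟩
    · rintro ⟨i, ⟨h₁, h₂⟩, rfl⟩
      exact ⟨⟨by omega, by omega⟩, (totalRise_shuffle_add_iff h s σ₁ σ₂ i).2 h₂⟩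
  have hITF : (ITF (m + 1) : ℚ[X]) = ∑ σ : Equiv.Perm (Fin (3 * (m + 1))),
      if σ ∈ SF (m + 1) ∧ ∀ i < m, totalRise _ σ i then 1 else 0 := by
    rw [ITF, ← sum_filter, sum_const, nsmul_one]
    congr 2
    ext σ
    simp
  have hris : risPoly k = ∑ σ : Equiv.Perm (Fin (3 * k)),
      if σ ∈ SF k then X ^ risT k σ else 0 := by
    simp [risPoly]
  have hcard : (((3 * (m + 1 + k)).choose (3 * (m + 1)) : ℕ) : ℚ[X]) =
      ∑ _s : {s : Finset (Fin (3 * (m + 1 + k))) // #s = 3 * (m + 1)}, 1 := by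
    simp [Fintype.card_finset_len]
  have htail : tailRisPoly (m + 1 + k) m (m + 1) = ∑ σ : Equiv.Perm (Fin (3 * (m + 1 + k))),
      if σ ∈ SF (m + 1 + k) then if ∀ i < m, totalRise _ σ i then
        X ^ #{i ∈ Ico (m + 1) (m + 1 + k) | totalRise _ σ i} else 0 else 0 := by
    simp [tailRisPoly, sum_filter]
  rw [htail, hcard, hITF, hris, mul_assoc, sum_mul_sum, ← Fintype.sum_prod_type', sum_mul_sum,
    ← Fintype.sum_prod_type']
  refine (Fintype.sum_bijective _ (shuffle_bijective h) _ _ fun ⟨s, σ₁, σ₂⟩ => ?_).symm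
  have hrise : (∀ i < m, totalRise _ (shuffle h s σ₁ σ₂) i) ↔ ∀ i < m, totalRise _ σ₁ i :=
    forall₂_congr fun i hi => totalRise_shuffle_iff h s σ₁ σ₂ (by omega)
  simp only [hexp, hrise, shuffle_mem_SF_iff]
  split_ifs <;> simp_all

theorem sum_range_three_mul_add_one {M : Type*} [AddCommMonoid M] {f : ℕ → M}
    (hf : ∀ i, i % 3 ≠ 0 → f i = 0) (n : ℕ) :
    ∑ i ∈ range (3 * n + 1), f i = ∑ i ∈ range (n + 1), f (3 * i) := by
  induction n with
  | zero => simp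
  | succ n ih =>
    rw [sum_range_succ _ (n + 1), ← ih, show 3 * (n + 1) + 1 = 3 * n + 1 + 1 + 1 + 1 by ring,
      sum_range_succ, sum_range_succ, sum_range_succ, hf (3 * n + 1) (by omega),
      hf (3 * n + 1 + 1) (by omega), add_zero, add_zero]
    rfl

theorem risPoly_zero : risPoly 0 = 1 := by
  simp [risPoly, SF, risT]

theorem coeff_RTser_three_mul (n : ℕ) :
    PowerSeries.coeff (3 * n) RTser = C (((3 * n).factorial : ℚ)⁻¹) * risPoly n := by
  rcases eq_or_ne n 0 with rfl | hn
  · simp [RTser, risPoly_zero]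
  · rw [RTser, PowerSeries.coeff_mk, if_neg (by omega), if_pos (Nat.mul_mod_right 3 n), ← risPoly,
      Nat.mul_div_cancel_left n three_pos]

theorem coeff_RTser_of_mod_ne_zero {m : ℕ} (hm : m % 3 ≠ 0) :
    PowerSeries.coeff m RTser = 0 := by
  have : m ≠ 0 := by rintro rfl; simp at hm
  simp [RTser, hm, this]

theorem coeff_GTser_zero : PowerSeries.coeff 0 GTser = 1 := by
  simp [GTser]

theorem coeff_GTser_three_mul_succ (m : ℕ) :
    PowerSeries.coeff (3 * (m + 1)) GTser =
      -(C (((3 * (m + 1)).factorial : ℚ)⁻¹) * (X - 1) ^ m * (ITF (m + 1) : ℚ[X])) := by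
  simp [GTser]

theorem coeff_GTser_of_mod_ne_zero {m : ℕ} (hm : m % 3 ≠ 0) :
    PowerSeries.coeff m GTser = 0 := by
  have : m ≠ 0 := by rintro rfl; simp at hm
  simp [GTser, hm, this]

theorem C_inv_factorial_mul_choose (a b : ℕ) :
    (C (((a + b).factorial : ℚ)⁻¹) * ((a + b).choose a : ℚ[X])) =
      C ((a.factorial : ℚ)⁻¹) * C ((b.factorial : ℚ)⁻¹) := by
  rw [← map_natCast C, ← C_mul, ← C_mul, Nat.cast_add_choose]
  congr 1
  have := Nat.factorial_ne_zero (a + b)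
  field_simp

end ShuffleDecomposition

theorem RTser_mul : RTser * GTser = 1 := by
  rw [mul_comm]
  ext1 m
  rw [PowerSeries.coeff_mul, Finset.Nat.sum_antidiagonal_eq_sum_range_succ
    (fun i j => PowerSeries.coeff i GTser * PowerSeries.coeff j RTser), PowerSeries.coeff_one]
  by_cases hm : m % 3 = 0
  · obtain ⟨n, rfl⟩ := Nat.dvd_of_mod_eq_zero hm
    rw [Nat.succ_eq_add_one, sum_range_three_mul_add_one fun i hi => by
        rw [coeff_GTser_of_mod_ne_zero hi, zero_mul],
      Finset.sum_range_succ', mul_zero, coeff_GTser_zero, one_mul, Nat.sub_zero,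
      coeff_RTser_three_mul]
    rcases eq_or_ne n 0 with rfl | hn
    · simp [risPoly_zero]
    · rw [if_neg (by omega), risPoly_eq_sum hn, Finset.mul_sum, ← Finset.sum_add_distrib]
      refine Finset.sum_eq_zero fun i hi => ?_
      obtain ⟨k, rfl⟩ := Nat.exists_eq_add_of_le (Nat.succ_le_of_lt (Finset.mem_range.1 hi))
      rw [Nat.succ_eq_add_one, tailRisPoly_shuffle, coeff_GTser_three_mul_succ, ← Nat.mul_sub,
        Nat.add_sub_cancel_left, coeff_RTser_three_mul, mul_add 3 (i + 1) k]
      linear_combination (Polynomial.X - 1) ^ i * (ITF (i + 1) : Polynomial ℚ) * risPoly k *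
        C_inv_factorial_mul_choose (3 * (i + 1)) (3 * k)
  · rw [if_neg (by rintro rfl; simp at hm)]
    refine Finset.sum_eq_zero fun i hi => ?_
    by_cases h : i % 3 = 0
    · have := Finset.mem_range.1 hi
      rw [coeff_RTser_of_mod_ne_zero (by omega), mul_zero]
    · rw [coeff_GTser_of_mod_ne_zero h, zero_mul]
end

section
/- In the ring ℚ[x][[t]], the following identity holds: (1 + Σ_{n≥1} (t^{3n}/(3n)!) · Σ_{σ ∈ SF_n} x^{risA(σ)}) · (1 − Σ_{n≥1} (t^{3n}/(3n)!) (x−1)^{n−1} · IAF_n) = 1. -/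
/-- 0-based shrub index `j` is an adjacent rise (1-based rise index `i = j+1`):
`σ(3i) < σ(3i+2)` in 1-based terms. -/
def adjRise (n : ℕ) (σ : Equiv.Perm (Fin (3*n))) (j : ℕ) : Prop :=
  ∃ h : 3*j+4 < 3*n, σ ⟨3*j+2, by omega⟩ < σ ⟨3*j+4, h⟩

instance (n : ℕ) (σ : Equiv.Perm (Fin (3*n))) : DecidablePred (adjRise n σ) :=
  fun _ => by unfold adjRise; infer_instance

/-- `risA σ`: the number of adjacent rises of `σ`. -/
def risA (n : ℕ) (σ : Equiv.Perm (Fin (3*n))) : ℕ :=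
  ((Finset.range n).filter (adjRise n σ)).card

/-- `IAF n`: the number of `σ ∈ SF n` for which every `i ∈ {1,…,n-1}` is an
adjacent rise. -/
def IAF (n : ℕ) : ℕ := ((SF n).filter fun σ => ∀ j < n - 1, adjRise n σ j).card

/-- The EGF `1 + Σ_{n≥1} (t^(3n)/(3n)!) Σ_{σ ∈ SF n} x^(risA σ)` in `ℚ[x][[t]]`. -/
noncomputable def RAser : PowerSeries (Polynomial ℚ) :=
  PowerSeries.mk fun m =>
    if m = 0 then 1
    else if m % 3 = 0 then
      Polynomial.C ((m.factorial : ℚ)⁻¹) * ∑ σ ∈ SF (m / 3), Polynomial.X ^ risA (m / 3) σ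
    else 0

/-- The series `1 - Σ_{n≥1} (t^(3n)/(3n)!) (x-1)^(n-1) ⋅ IAF n` in `ℚ[x][[t]]`. -/
noncomputable def GAser : PowerSeries (Polynomial ℚ) :=
  PowerSeries.mk fun m =>
    if m = 0 then 1
    else if m % 3 = 0 then
      -(Polynomial.C ((m.factorial : ℚ)⁻¹) * (Polynomial.X - 1) ^ (m / 3 - 1) *
        (IAF (m / 3) : Polynomial ℚ))
    else 0

/-- The word of a permutation of `Fin m`, extended by `0` to a function `ℕ → ℕ`. -/
def permWord {m : ℕ} (σ : Equiv.Perm (Fin m)) (p : ℕ) : ℕ :=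
  if h : p < m then (σ ⟨p, h⟩ : ℕ) else 0

/-- The first `3 * n` letters of `w` satisfy the shrub inequalities. -/
abbrev IsShrubWord (n : ℕ) (w : ℕ → ℕ) : Prop :=
  ∀ i < n, w (3 * i) < w (3 * i + 1) ∧ w (3 * i) < w (3 * i + 2)

/-- The `j`-th and `(j + 1)`-st shrubs of `w` form an adjacent rise. -/
abbrev IsRise (w : ℕ → ℕ) (j : ℕ) : Prop := w (3 * j + 2) < w (3 * j + 4)

theorem permWord_of_lt {m : ℕ} (σ : Equiv.Perm (Fin m)) {p : ℕ} (h : p < m) :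
    permWord σ p = σ ⟨p, h⟩ := dif_pos h

theorem permWord_fin {m : ℕ} (σ : Equiv.Perm (Fin m)) (i : Fin m) :
    permWord σ i = σ i := permWord_of_lt σ i.2

theorem mem_SF_iff_s5 {n : ℕ} {σ : Equiv.Perm (Fin (3 * n))} :
    σ ∈ SF n ↔ IsShrubWord n (permWord σ) := by
  simp only [SF, Finset.mem_filter, Finset.mem_univ, true_and, IsShrubWord]
  refine forall₂_congr fun i hi => ?_
  rw [permWord_of_lt σ (show 3 * i < 3 * n by omega),
    permWord_of_lt σ (show 3 * i + 1 < 3 * n by omega),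
    permWord_of_lt σ (show 3 * i + 2 < 3 * n by omega)]
  exact ⟨fun ⟨_, h⟩ => h, fun h => ⟨by omega, h⟩⟩

theorem adjRise_iff {n : ℕ} {σ : Equiv.Perm (Fin (3 * n))} {j : ℕ} :
    adjRise n σ j ↔ j < n - 1 ∧ IsRise (permWord σ) j := by
  unfold adjRise
  constructor
  · rintro ⟨h, h'⟩
    refine ⟨by omega, ?_⟩
    rw [IsRise, permWord_of_lt σ h, permWord_of_lt σ (show 3 * j + 2 < 3 * n by omega)]
    exact h'
  · rintro ⟨h, h'⟩
    refine ⟨by omega, ?_⟩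
    rw [IsRise, permWord_of_lt σ (show 3 * j + 4 < 3 * n by omega),
      permWord_of_lt σ (show 3 * j + 2 < 3 * n by omega)] at h'
    exact h'

theorem risA_eq (n : ℕ) (σ : Equiv.Perm (Fin (3 * n))) :
    risA n σ = ((Finset.range (n - 1)).filter (IsRise (permWord σ))).card := by
  unfold risA
  congr 1
  ext j
  simp only [Finset.mem_filter, Finset.mem_range, adjRise_iff]
  constructor
  · exact fun h => h.2
  · exact fun h => ⟨by omega, h⟩

theorem IAF_eq (n : ℕ) : IAF n = (Finset.univ.filter fun σ : Equiv.Perm (Fin (3 * n)) =>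
    IsShrubWord n (permWord σ) ∧ ∀ j < n - 1, IsRise (permWord σ) j).card := by
  unfold IAF
  congr 1
  ext σ
  simp only [Finset.mem_filter, Finset.mem_univ, true_and, mem_SF_iff_s5, adjRise_iff]
  exact and_congr_right fun _ => forall₂_congr fun j hj => by simp [hj]

/-- `F w` depends only on the relative order of the first `a` letters of `w`. -/
def OrderInvariant {R : Type*} (a : ℕ) (F : (ℕ → ℕ) → R) : Prop :=
  ∀ v w : ℕ → ℕ, (∀ i < a, ∀ j < a, (v i < v j ↔ w i < w j)) → F v = F w

/-- An order invariant function has the same sum over all rearrangements of any word with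
distinct letters. -/
theorem OrderInvariant.sum_comp_perm {R : Type*} [AddCommMonoid R] {a : ℕ}
    {F : (ℕ → ℕ) → R} (hF : OrderInvariant a F) {u : Fin a → ℕ} (hu : Function.Injective u)
    (W : Equiv.Perm (Fin a) → ℕ → ℕ) (hW : ∀ π (i : Fin a), W π i = u (π i)) :
    ∑ π, F (W π) = ∑ π : Equiv.Perm (Fin a), F (permWord π) := by
  have hs : StrictMono (u ∘ Tuple.sort u) :=
    (Tuple.monotone_sort u).strictMono_of_injective (hu.comp (Tuple.sort u).injective)
  rw [← Equiv.sum_comp (Equiv.mulLeft (Tuple.sort u)) (fun π => F (W π))]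
  refine Finset.sum_congr rfl fun π _ => hF _ _ fun i hi j hj => ?_
  have key : ∀ (k : ℕ) (hk : k < a),
      W (Tuple.sort u * π) k = (u ∘ Tuple.sort u) (π ⟨k, hk⟩) := fun k hk => hW _ ⟨k, hk⟩
  rw [Equiv.coe_mulLeft, key i hi, key j hj, permWord_of_lt π hi, permWord_of_lt π hj,
    hs.lt_iff_lt, Fin.lt_def]

/-- Sums over permutations of order invariant functions of an initial and of a final segment
are multiplicative after division by factorials. -/
theorem OrderInvariant.sum_mul_sum {R : Type*} [CommSemiring R] {a b m : ℕ} (hm : m = a + b)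
    {F G : (ℕ → ℕ) → R} (hF : OrderInvariant a F) (hG : OrderInvariant b G) :
    (a.factorial * b.factorial : R) *
        ∑ σ : Equiv.Perm (Fin m), F (permWord σ) * G (fun p => permWord σ (a + p)) =
      m.factorial * ((∑ π : Equiv.Perm (Fin a), F (permWord π)) *
        ∑ ρ : Equiv.Perm (Fin b), G (permWord ρ)) := by
  subst hm
  set H : Equiv.Perm (Fin (a + b)) → R :=
    fun σ => F (permWord σ) * G (fun p => permWord σ (a + p)) with hH
  let e (π : Equiv.Perm (Fin a)) (ρ : Equiv.Perm (Fin b)) : Equiv.Perm (Fin (a + b)) :=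
    finSumFinEquiv.permCongr (Equiv.Perm.sumCongr π ρ)
  have hleft : ∀ σ π ρ (i : Fin a), permWord (σ * e π ρ) i = σ (Fin.castAdd b (π i)) := by
    intro σ π ρ i
    have := permWord_fin (σ * e π ρ) (Fin.castAdd b i)
    simpa [e, Equiv.permCongr_apply] using this
  have hright : ∀ σ π ρ (i : Fin b), permWord (σ * e π ρ) (a + i) = σ (Fin.natAdd a (ρ i)) := by
    intro σ π ρ i
    have := permWord_fin (σ * e π ρ) (Fin.natAdd a i)
    simpa [e, Equiv.permCongr_apply] using this
  have hsplit : ∀ σ, ∑ π, ∑ ρ, H (σ * e π ρ) =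
      (∑ π : Equiv.Perm (Fin a), F (permWord π)) *
        ∑ ρ : Equiv.Perm (Fin b), G (permWord ρ) := by
    intro σ
    have h1 : ∀ π ρ, H (σ * e π ρ) = F (permWord (σ * e π 1)) *
        G (fun p => permWord (σ * e 1 ρ) (a + p)) := by
      intro π ρ
      have hf : F (permWord (σ * e π ρ)) = F (permWord (σ * e π 1)) := by
        refine hF _ _ fun i hi j hj => ?_
        have h := fun ρ' => hleft σ π ρ' ⟨i, hi⟩
        have h' := fun ρ' => hleft σ π ρ' ⟨j, hj⟩
        simp only at h h'
        rw [h, h, h', h']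
      have hg : G (fun p => permWord (σ * e π ρ) (a + p)) =
          G (fun p => permWord (σ * e 1 ρ) (a + p)) := by
        refine hG _ _ fun i hi j hj => ?_
        have h := fun π' => hright σ π' ρ ⟨i, hi⟩
        have h' := fun π' => hright σ π' ρ ⟨j, hj⟩
        simp only at h h'
        rw [h, h, h', h']
      rw [hH, ← hf, ← hg]
    simp_rw [h1, ← Finset.mul_sum, ← Finset.sum_mul]
    congr 1
    · exact hF.sum_comp_perm (u := fun i => σ (Fin.castAdd b i))
        (Fin.val_injective.comp (σ.injective.comp (Fin.castAdd_injective a b))) _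
        fun π i => hleft σ π 1 i
    · exact hG.sum_comp_perm (u := fun i => σ (Fin.natAdd a i))
        (Fin.val_injective.comp (σ.injective.comp (Fin.natAdd_injective b a))) _
        fun ρ i => hright σ 1 ρ i
  calc _ = ∑ π : Equiv.Perm (Fin a), ∑ ρ : Equiv.Perm (Fin b), ∑ σ, H (σ * e π ρ) := by
        have : ∀ π ρ, ∑ σ, H (σ * e π ρ) = ∑ σ, H σ :=
          fun π ρ => Equiv.sum_comp (Equiv.mulRight (e π ρ)) H
        simp [this, Fintype.card_perm, mul_assoc]
    _ = ∑ σ, ∑ π, ∑ ρ, H (σ * e π ρ) := by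
        rw [Finset.sum_comm]
        conv_lhs => enter [2, ρ]; rw [Finset.sum_comm]
        rw [Finset.sum_comm]
        exact Finset.sum_congr rfl fun σ _ => Finset.sum_comm
    _ = _ := by simp [hsplit, Fintype.card_perm]

/-- Expansion of `x ^ #{i < M | b i}` according to a final run of elements satisfying `b`. -/
theorem pow_card_filter_eq_sum_antidiagonal {R : Type*} [CommRing R] (x : R) (b : ℕ → Prop)
    [DecidablePred b] (M : ℕ) :
    x ^ ((Finset.range M).filter b).card =
      ∑ p ∈ Finset.HasAntidiagonal.antidiagonal M, (x - 1) ^ p.2 *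
        (x ^ ((Finset.range (p.1 - 1)).filter b).card *
          if ∀ i < p.2, b (p.1 + i) then 1 else 0) := by
  induction M with
  | zero => simp
  | succ M ih =>
    rw [Finset.Nat.sum_antidiagonal_succ']
    have step : ∀ p ∈ Finset.HasAntidiagonal.antidiagonal M, (x - 1) ^ (p.2 + 1) *
        (x ^ ((Finset.range (p.1 - 1)).filter b).card *
          if ∀ i < p.2 + 1, b (p.1 + i) then 1 else 0) =
        ((x - 1) * if b M then 1 else 0) * ((x - 1) ^ p.2 *
        (x ^ ((Finset.range (p.1 - 1)).filter b).card *
          if ∀ i < p.2, b (p.1 + i) then 1 else 0)) := by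
      intro p hp
      rw [Finset.HasAntidiagonal.mem_antidiagonal] at hp
      have : (∀ i < p.2 + 1, b (p.1 + i)) ↔ b M ∧ ∀ i < p.2, b (p.1 + i) := by
        rw [Nat.forall_lt_succ_right, hp, and_comm]
      simp only [this]
      split_ifs <;> first | ring1 | (exfalso; tauto)
    rw [Finset.sum_congr rfl step, ← Finset.mul_sum, ← ih, Finset.range_add_one,
      Finset.filter_insert]
    by_cases h : b M
    · rw [if_pos h, if_pos h, Finset.card_insert_of_notMem (by simp)]
      simp
      ring
    · simp [h]

theorem isShrubWord_add {a k : ℕ} {w : ℕ → ℕ} :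
    IsShrubWord (a + k) w ↔ IsShrubWord a w ∧ IsShrubWord k fun p => w (3 * a + p) := by
  constructor
  · refine fun h => ⟨fun i hi => h i (by omega), fun i hi => ?_⟩
    simpa only [mul_add, add_assoc] using h (a + i) (by omega)
  · rintro ⟨h, h'⟩ i hi
    rcases lt_or_ge i a with hia | hia
    · exact h i hia
    · obtain ⟨j, rfl⟩ := Nat.exists_eq_add_of_le hia
      simpa only [mul_add, add_assoc] using h' j (by omega)

open Polynomial in
/-- The generating polynomial weight of a word with `n` shrubs. -/
noncomputable def riseWeight (n : ℕ) (w : ℕ → ℕ) : ℚ[X] :=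
  if IsShrubWord n w then X ^ ((Finset.range (n - 1)).filter (IsRise w)).card else 0

open Polynomial in
/-- The indicator of the words with `n` shrubs all of whose adjacent pairs are rises. -/
noncomputable def allRiseWeight (n : ℕ) (w : ℕ → ℕ) : ℚ[X] :=
  if IsShrubWord n w ∧ ∀ j < n - 1, IsRise w j then 1 else 0

theorem isShrubWord_congr {n : ℕ} {v w : ℕ → ℕ}
    (h : ∀ i < 3 * n, ∀ j < 3 * n, (v i < v j ↔ w i < w j)) :
    IsShrubWord n v ↔ IsShrubWord n w :=
  forall₂_congr fun i hi => and_congr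
    (h _ (by omega) _ (by omega)) (h _ (by omega) _ (by omega))

theorem isRise_congr {n : ℕ} {v w : ℕ → ℕ}
    (h : ∀ i < 3 * n, ∀ j < 3 * n, (v i < v j ↔ w i < w j)) {j : ℕ} (hj : j < n - 1) :
    IsRise v j ↔ IsRise w j :=
  h _ (by omega) _ (by omega)

theorem orderInvariant_riseWeight (n : ℕ) : OrderInvariant (3 * n) (riseWeight n) := by
  intro v w h
  have : (Finset.range (n - 1)).filter (IsRise v) = (Finset.range (n - 1)).filter (IsRise w) :=
    Finset.filter_congr fun j hj => isRise_congr h (Finset.mem_range.1 hj)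
  simp only [riseWeight, isShrubWord_congr h, this]

theorem orderInvariant_allRiseWeight (n : ℕ) :
    OrderInvariant (3 * n) (allRiseWeight n) := by
  intro v w h
  have : (∀ j < n - 1, IsRise v j) ↔ ∀ j < n - 1, IsRise w j :=
    forall₂_congr fun j hj => isRise_congr h hj
  simp only [allRiseWeight, isShrubWord_congr h, this]

open Polynomial in
theorem riseWeight_succ (M : ℕ) (w : ℕ → ℕ) :
    riseWeight (M + 1) w = ∑ p ∈ Finset.HasAntidiagonal.antidiagonal M, (X - 1) ^ p.2 *
      (riseWeight p.1 w * allRiseWeight (p.2 + 1) fun q => w (3 * p.1 + q)) := by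
  have step : ∀ p ∈ Finset.HasAntidiagonal.antidiagonal M, (X - 1 : ℚ[X]) ^ p.2 *
      (riseWeight p.1 w * allRiseWeight (p.2 + 1) fun q => w (3 * p.1 + q)) =
      (if IsShrubWord (M + 1) w then 1 else 0) * ((X - 1) ^ p.2 *
        (X ^ ((Finset.range (p.1 - 1)).filter (IsRise w)).card *
          if ∀ i < p.2, IsRise w (p.1 + i) then 1 else 0)) := by
    intro p hp
    rw [Finset.HasAntidiagonal.mem_antidiagonal] at hp
    rw [← hp, add_assoc]
    simp only [riseWeight, allRiseWeight, isShrubWord_add (a := p.1) (k := p.2 + 1),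
      Nat.add_sub_cancel, IsRise, mul_add, add_assoc]
    split_ifs <;> first | ring1 | (exfalso; tauto)
  rw [Finset.sum_congr rfl step, ← Finset.mul_sum,
    ← pow_card_filter_eq_sum_antidiagonal X (IsRise w) M]
  simp [riseWeight]

open Polynomial in
theorem coeff_RAser_mul_three (n : ℕ) : PowerSeries.coeff (3 * n) RAser =
    C (((3 * n).factorial : ℚ)⁻¹) *
      ∑ σ : Equiv.Perm (Fin (3 * n)), riseWeight n (permWord σ) := by
  have hsum : ∑ σ ∈ SF n, (X : ℚ[X]) ^ risA n σ =
      ∑ σ : Equiv.Perm (Fin (3 * n)), riseWeight n (permWord σ) := by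
    have : SF n = Finset.univ.filter fun σ => IsShrubWord n (permWord σ) := by
      ext σ
      simp [mem_SF_iff_s5]
    rw [this, Finset.sum_filter]
    exact Finset.sum_congr rfl fun σ _ => by rw [riseWeight, risA_eq]
  rw [← hsum, RAser, PowerSeries.coeff_mk]
  rcases Nat.eq_zero_or_pos n with rfl | hn
  · have : SF 0 = Finset.univ := by simp [SF]
    simp [this, risA]
  · rw [if_neg (by omega), if_pos (by omega), Nat.mul_div_cancel_left n (by norm_num)]

open Polynomial in
theorem coeff_GAser_mul_three_succ (n : ℕ) : PowerSeries.coeff (3 * (n + 1)) GAser =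
    -(C (((3 * (n + 1)).factorial : ℚ)⁻¹) * (X - 1) ^ n *
      ∑ σ : Equiv.Perm (Fin (3 * (n + 1))), allRiseWeight (n + 1) (permWord σ)) := by
  rw [GAser, PowerSeries.coeff_mk, if_neg (by omega), if_pos (by omega),
    Nat.mul_div_cancel_left _ (by norm_num), IAF_eq]
  simp [allRiseWeight, Finset.sum_boole]

open Polynomial in
theorem coeff_RAser_mul_three_succ (M : ℕ) : PowerSeries.coeff (3 * (M + 1)) RAser =
    -∑ p ∈ Finset.HasAntidiagonal.antidiagonal M, PowerSeries.coeff (3 * p.1) RAser *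
      PowerSeries.coeff (3 * (p.2 + 1)) GAser := by
  rw [coeff_RAser_mul_three, Finset.sum_congr rfl fun σ _ => riseWeight_succ M (permWord σ),
    Finset.sum_comm, Finset.mul_sum, ← Finset.sum_neg_distrib]
  refine Finset.sum_congr rfl fun p hp => ?_
  rw [Finset.HasAntidiagonal.mem_antidiagonal] at hp
  rw [coeff_RAser_mul_three, coeff_GAser_mul_three_succ, ← Finset.mul_sum]
  have key := OrderInvariant.sum_mul_sum (m := 3 * (M + 1)) (by omega)
    (orderInvariant_riseWeight p.1) (orderInvariant_allRiseWeight (p.2 + 1))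
  have hC : ∀ k : ℕ, C ((k.factorial : ℚ)⁻¹) * (k.factorial : ℚ[X]) = 1 := by
    intro k
    rw [← C_eq_natCast, ← C_mul, inv_mul_cancel₀ (by exact_mod_cast k.factorial_ne_zero), C_1]
  set S := ∑ σ : Equiv.Perm (Fin (3 * (M + 1))), riseWeight p.1 (permWord σ) *
    allRiseWeight (p.2 + 1) fun q => permWord σ (3 * p.1 + q)
  set A := C (((3 * (M + 1)).factorial : ℚ)⁻¹)
  set B := C (((3 * p.1).factorial : ℚ)⁻¹)
  set D := C (((3 * (p.2 + 1)).factorial : ℚ)⁻¹)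
  linear_combination A * B * D * (X - 1) ^ p.2 * key
    - A * S * (X - 1) ^ p.2 * (D * (3 * (p.2 + 1)).factorial * hC (3 * p.1) + hC (3 * (p.2 + 1)))
    + B * D * (X - 1) ^ p.2 * ((∑ π : Equiv.Perm (Fin (3 * p.1)), riseWeight p.1 (permWord π)) *
      ∑ ρ : Equiv.Perm (Fin (3 * (p.2 + 1))), allRiseWeight (p.2 + 1) (permWord ρ)) *
      hC (3 * (M + 1))

theorem coeff_RAser_of_not_dvd {m : ℕ} (h : ¬ 3 ∣ m) : PowerSeries.coeff m RAser = 0 := by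
  rw [RAser, PowerSeries.coeff_mk, if_neg (by omega), if_neg (by omega)]

theorem coeff_GAser_of_not_dvd {m : ℕ} (h : ¬ 3 ∣ m) : PowerSeries.coeff m GAser = 0 := by
  rw [GAser, PowerSeries.coeff_mk, if_neg (by omega), if_neg (by omega)]

theorem sum_antidiagonal_three_mul {R : Type*} [AddCommMonoid R] (f : ℕ × ℕ → R) (N : ℕ)
    (hf : ∀ p, ¬ (3 ∣ p.1 ∧ 3 ∣ p.2) → f p = 0) :
    ∑ p ∈ Finset.HasAntidiagonal.antidiagonal (3 * N), f p =
      ∑ p ∈ Finset.HasAntidiagonal.antidiagonal N, f (3 * p.1, 3 * p.2) := by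
  symm
  refine Finset.sum_of_injOn (fun p => (3 * p.1, 3 * p.2)) ?_ ?_ ?_ fun _ _ => rfl
  · rintro ⟨a, b⟩ - ⟨c, d⟩ - h
    simp only [Prod.mk.injEq] at h ⊢
    omega
  · rintro ⟨a, b⟩ h
    simp only [Finset.mem_coe, Finset.HasAntidiagonal.mem_antidiagonal] at h ⊢
    omega
  · rintro ⟨a, b⟩ h h'
    refine hf _ fun ⟨⟨c, hc⟩, ⟨d, hd⟩⟩ => h' ⟨(c, d), ?_, ?_⟩
    · simp only [Finset.mem_coe, Finset.HasAntidiagonal.mem_antidiagonal] at h hc hd ⊢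
      omega
    · simp only at hc hd
      simp [hc, hd]

theorem RAser_mul : RAser * GAser = 1 := by
  ext1 n
  rw [PowerSeries.coeff_mul, PowerSeries.coeff_one]
  by_cases hn : 3 ∣ n
  · obtain ⟨N, rfl⟩ := hn
    rw [sum_antidiagonal_three_mul]
    · cases N with
      | zero => simp [RAser, GAser]
      | succ M =>
        rw [Finset.Nat.sum_antidiagonal_succ', if_neg (by omega)]
        simp only [coeff_RAser_mul_three_succ M]
        simp [GAser]
    · intro p hp
      rcases not_and_or.1 hp with h | h
      · rw [coeff_RAser_of_not_dvd h, zero_mul]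
      · rw [coeff_GAser_of_not_dvd h, mul_zero]
  · rw [if_neg (by rintro rfl; simp at hn)]
    refine Finset.sum_eq_zero fun p hp => ?_
    rw [Finset.HasAntidiagonal.mem_antidiagonal] at hp
    by_cases h : 3 ∣ p.1
    · rw [coeff_GAser_of_not_dvd (by omega), mul_zero]
    · rw [coeff_RAser_of_not_dvd h, zero_mul]
end

section
/- For every n ≥ 1, (n+1)! · (2n+1)! · ILF_n = 4^n · (3n)!; that is, the number of binary-shrub-forest permutations σ of size n for which every i ∈ {1,…,n−1} is a lexicographic rise equals 4^n (3n)!/((n+1)!(2n+1)!). -/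
/-- 0-based shrub index `j` is a lexicographic rise (1-based rise index `i = j+1`):
`σ(3i-2) < σ(3i+1)`, `σ(3i-1) < σ(3i+2)` and `σ(3i) < σ(3i+3)` in 1-based terms. -/
def lexRise (n : ℕ) (σ : Equiv.Perm (Fin (3*n))) (j : ℕ) : Prop :=
  ∃ h : 3*j+5 < 3*n,
    σ ⟨3*j, by omega⟩ < σ ⟨3*j+3, by omega⟩ ∧
    σ ⟨3*j+1, by omega⟩ < σ ⟨3*j+4, by omega⟩ ∧
    σ ⟨3*j+2, by omega⟩ < σ ⟨3*j+5, h⟩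

instance (n : ℕ) (σ : Equiv.Perm (Fin (3*n))) : DecidablePred (lexRise n σ) :=
  fun _ => by unfold lexRise; infer_instance

/-- `risL σ`: the number of lexicographic rises of `σ`. -/
def risL (n : ℕ) (σ : Equiv.Perm (Fin (3*n))) : ℕ :=
  ((Finset.range n).filter (lexRise n σ)).card

/-- `ILF n`: the number of `σ ∈ SF n` for which every `i ∈ {1,…,n-1}` is a
lexicographic rise. -/
def ILF (n : ℕ) : ℕ := ((SF n).filter fun σ => ∀ j < n - 1, lexRise n σ j).card

open PowerSeries in
/-- Contracting maps of a power series ring in the `X`-adic topology have fixed points. -/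
theorem PowerSeries.exists_eq_add_X_mul {R : Type*} [CommRing R] (a : R⟦X⟧) (P : R⟦X⟧ → R⟦X⟧)
    (hP : ∀ f g, f - g ∣ P f - P g) : ∃ f : R⟦X⟧, f = a + X * P f := by
  let F : ℕ → R⟦X⟧ := fun n => (fun f => a + X * P f)^[n] 0
  have hF (n : ℕ) : F (n + 1) = a + X * P (F n) := Function.iterate_succ_apply' _ _ _
  have step (n : ℕ) : X ^ n ∣ F (n + 1) - F n := by
    induction n with
    | zero => simp
    | succ n ih =>
      have h : F (n + 1 + 1) - F (n + 1) = X * (P (F (n + 1)) - P (F n)) := by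
        rw [hF (n + 1), hF n]
        ring
      rw [h, pow_succ']
      exact mul_dvd_mul_left X (ih.trans (hP _ _))
  have stable (n k : ℕ) : X ^ n ∣ F (n + k) - F n := by
    induction k with
    | zero => simp
    | succ k ih =>
      have h := (pow_dvd_pow X (Nat.le_add_right n k)).trans (step (n + k))
      have := dvd_add h ih
      rwa [sub_add_sub_cancel] at this
  let f : R⟦X⟧ := mk fun n => coeff n (F (n + 1))
  have near (n : ℕ) : X ^ n ∣ f - F n := by
    rw [X_pow_dvd_iff]
    intro m hm
    obtain ⟨k, rfl⟩ := Nat.exists_eq_add_of_lt hm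
    have h := X_pow_dvd_iff.1 (stable (m + 1) k) m (Nat.lt_succ_self m)
    rw [map_sub, sub_eq_zero] at h ⊢
    rw [coeff_mk, ← h]
    congr 2
    omega
  refine ⟨f, sub_eq_zero.1 <| PowerSeries.ext fun n => ?_⟩
  have h1 := near (n + 1)
  have h2 : X ^ (n + 1) ∣ X * (P f - P (F n)) := by
    rw [pow_succ']
    exact mul_dvd_mul_left X ((near n).trans (hP _ _))
  have h3 : f - (a + X * P f) = (f - F (n + 1)) - X * (P f - P (F n)) := by
    rw [hF]
    ring
  rw [h3]
  simpa using X_pow_dvd_iff.1 (dvd_sub h1 h2) n (Nat.lt_succ_self n)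

/-- `krewerasCount m i j`: the number of walks of length `m` with steps `(1,1)`, `(-1,0)`, `(0,-1)`
in the quarter plane, from the origin to `(i, j)`. -/
def krewerasCount : ℕ → ℕ → ℕ → ℕ
  | 0, 0, 0 => 1
  | 0, _, _ => 0
  | m + 1, 0, j => krewerasCount m 1 j + krewerasCount m 0 (j + 1)
  | m + 1, i + 1, 0 => krewerasCount m (i + 2) 0 + krewerasCount m (i + 1) 1
  | m + 1, i + 1, j + 1 =>
    krewerasCount m (i + 2) (j + 1) + krewerasCount m (i + 1) (j + 2) + krewerasCount m i j

theorem kreweras_kernel_equation {B : Type*} [CommRing B] [IsDomain B]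
    {t x y c a b E Q : B} (ha : t ^ 2 * x ^ 2 * a ^ 2 - (x - 2 * t) * a = c - x)
    (hb : t ^ 2 * y ^ 2 * b ^ 2 - (y - 2 * t) * b = c - y)
    (hE : (x - y) * E = x * a - y * b) (hQ : Q * (1 - t * x * y * E) = E)
    (hxy : x - y ≠ 0) (h0 : 1 - t * x * y * E ≠ 0) :
    x * y * Q = x * y - t * x * a - t * y * b + t * (x * Q + y * Q + x ^ 2 * y ^ 2 * Q) := by
  apply mul_right_cancel₀ h0
  apply mul_left_cancel₀ hxy
  linear_combination (x - y) * (x * y - t * x - t * y - t * x ^ 2 * y ^ 2) * hQ +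
    (x * y - t * x - t * y - t * x ^ 2 * y ^ 2) * hE +
    t * x * y * (x * y - t * x * a - t * y * b) * hE - x * y * ha + x * y * hb

open PowerSeries in
theorem exists_kreweras_series {A : Type*} [CommRing A] [IsDomain A] {t c : A} {S : A⟦X⟧}
    (hS : C t ^ 2 * X ^ 2 * S ^ 2 - (X - 2 * C t) * S = C c - X) :
    ∃ Q : A⟦X⟧⟦X⟧, constantCoeff (constantCoeff Q) = constantCoeff S ∧
      C X * X * Q = C X * X - C (C t) * C X * C S - C (C t) * X * map C S
        + C (C t) * (C X * Q + X * Q + C X ^ 2 * X ^ 2 * Q) := by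
  let E : A⟦X⟧⟦X⟧ := mk fun j => mk fun i => coeff (i + j) S
  have hx := congrArg (C (R := A⟦X⟧)) hS
  have hy := congrArg (map (C (R := A))) hS
  simp only [map_sub, map_mul, map_pow, map_X, map_C, map_ofNat] at hx hy
  have hE : (C X - X) * E = C X * C S - X * map C S := by
    ext j i
    rcases j with _ | j <;> rcases i with _ | i <;>
      simp [E, sub_mul, coeff_succ_X_mul, coeff_zero_X_mul, ← map_mul, add_right_comm, add_assoc,
        -coeff_zero_eq_constantCoeff, coeff_C]
  have hxy : (C X - X : A⟦X⟧⟦X⟧) ≠ 0 := by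
    intro h
    have := congrArg (fun f => constantCoeff (coeff 1 f)) h
    simp at this
  obtain ⟨u, hu⟩ : IsUnit (1 - C (C t) * C X * X * E) := by
    rw [PowerSeries.isUnit_iff_constantCoeff]
    simp
  have hQ : E * (↑u⁻¹ : A⟦X⟧⟦X⟧) * (1 - C (C t) * C X * X * E) = E := by
    rw [← hu, mul_assoc, Units.inv_mul, mul_one]
  refine ⟨E * (↑u⁻¹ : A⟦X⟧⟦X⟧), ?_,
    kreweras_kernel_equation hx hy hE hQ hxy (hu ▸ u.ne_zero)⟩
  have := congrArg (fun f => constantCoeff (constantCoeff f)) hQ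
  simp only [map_mul, map_sub, map_one, constantCoeff_X, mul_zero, zero_mul, sub_zero,
    mul_one] at this
  simpa [E] using this

open PowerSeries in
theorem krewerasCount_eq_coeff {S : ℚ⟦X⟧⟦X⟧} {Q : ℚ⟦X⟧⟦X⟧⟦X⟧}
    (hQ : C X * X * Q = C X * X - C (C X) * C X * C S - C (C X) * X * map C S
      + C (C X) * (C X * Q + X * Q + C X ^ 2 * X ^ 2 * Q)) (m i j : ℕ) :
    (krewerasCount m i j : ℚ) = coeff m (coeff i (coeff j Q)) := by
  have hrec (i j : ℕ) : coeff i (coeff j Q) = coeff i (coeff j 1) +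
      X * (coeff i (coeff (j + 1) Q) + coeff (i + 1) (coeff j Q)
        + coeff i (coeff j (C X * (X * Q)))) := by
    have hQ' : C X * (X * Q) = C X * (X * 1) - C (C X) * (C X * C S) - C (C X) * (X * map C S)
        + C (C X) * (C X * Q + X * Q + C X * (X * (C X * (X * Q)))) := by
      linear_combination hQ
    have h := congrArg (fun f => coeff (i + 1) (coeff (j + 1) f)) hQ'
    simp only [map_add, map_sub, coeff_C_mul, coeff_succ_X_mul, coeff_map, coeff_succ_C,
      mul_zero, sub_zero] at h
    simpa only [coeff_C_mul] using h
  induction m generalizing i j with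
  | zero =>
    rw [hrec]
    rcases i with _ | i <;> rcases j with _ | j <;>
      simp [krewerasCount, coeff_zero_X_mul, coeff_one]
  | succ m ih =>
    rw [hrec]
    rcases i with _ | i <;> rcases j with _ | j <;>
      simp [krewerasCount, coeff_one, ih, coeff_succ_X_mul]
    all_goals ring

open PowerSeries in
theorem exists_kreweras_boundary_series : ∃ (v : ℚ⟦X⟧) (S : ℚ⟦X⟧⟦X⟧) (c : ℚ⟦X⟧),
    v = 1 + 4 * X ^ 3 * v ^ 3 ∧
    2 * constantCoeff S = v * (3 - v) ∧
    C X ^ 2 * X ^ 2 * S ^ 2 - (X - 2 * C X) * S = C c - X := by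
  obtain ⟨v, hv⟩ := PowerSeries.exists_eq_add_X_mul (1 : ℚ⟦X⟧) (fun f => 4 * X ^ 2 * f ^ 3) (by
    intro f g
    exact ⟨4 * X ^ 2 * (f ^ 2 + f * g + g ^ 2), by ring⟩)
  obtain ⟨P, hP⟩ := PowerSeries.exists_eq_add_X_mul (1 : ℚ⟦X⟧⟦X⟧)
    (fun f => C X ^ 2 * C v ^ 2 * f ^ 2) (by
    intro f g
    exact ⟨C X ^ 2 * C v ^ 2 * (f + g), by ring⟩)
  have hv' : v = 1 + 4 * X ^ 3 * v ^ 3 := by linear_combination hv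
  have hvC := congrArg (C (R := ℚ⟦X⟧)) hv'
  simp only [map_add, map_mul, map_pow, map_one, map_ofNat] at hvC
  refine ⟨v, C v * P * (1 - 2 * (C X * C v) ^ 3 * P), 2 * (X * v) - 4 * (X * v) ^ 4, hv', ?_, ?_⟩
  · have := congrArg constantCoeff hP
    simp only [map_add, map_mul, map_one, constantCoeff_X, zero_mul, add_zero] at this
    simp only [map_mul, map_sub, map_one, map_ofNat, map_pow, constantCoeff_C, this]
    linear_combination v * hv'
  · simp only [map_sub, map_mul, map_pow, map_ofNat]
    generalize (C v : ℚ⟦X⟧⟦X⟧) = V at *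
    generalize (C X : ℚ⟦X⟧⟦X⟧) = t at *
    generalize (X : ℚ⟦X⟧⟦X⟧) = x at *
    linear_combination (-(x * (1 - 2 * t ^ 3 * V ^ 3 * P) ^ 2)
      - 2 * t * V * (2 * t ^ 3 * V ^ 3 * (P + 1) - 1)) * hP
      - x * P * (1 - 2 * t ^ 3 * V ^ 3 * P) * hvC

open PowerSeries in
theorem kreweras_ode {v G : ℚ⟦X⟧} (hv : v = 1 + 4 * X ^ 3 * v ^ 3) (hG : 2 * G = v * (3 - v)) :
    2 * (X * d⁄dX ℚ (X * d⁄dX ℚ G)) + 9 * (X * d⁄dX ℚ G) + 9 * G =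
      54 * (X ^ 3 * (X * d⁄dX ℚ (X * d⁄dX ℚ G) + 3 * (X * d⁄dX ℚ G) + 2 * G)) + 9 := by
  have hd (n : ℕ) [n.AtLeastTwo] : d⁄dX ℚ (ofNat(n) : ℚ⟦X⟧) = 0 := by
    rw [← map_ofNat (C (R := ℚ)), derivative_C]
  have h3 : 2 * (3 - 2 * v) ≠ 0 := by
    intro h
    have h1 := congrArg constantCoeff hv
    have h2 := congrArg constantCoeff h
    simp at h1
    simp only [map_sub, map_mul, map_ofNat, map_zero, h1] at h2
    norm_num at h2
  have dv := congrArg (fun f => X * d⁄dX ℚ f) hv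
  have dG := congrArg (fun f => X * d⁄dX ℚ f) hG
  simp only [map_add, map_sub, Derivation.leibniz, Derivation.leibniz_pow, hd, derivative_X,
    smul_eq_mul, Derivation.map_one_eq_zero, nsmul_eq_mul] at dv dG
  norm_num at dv dG
  have hθv : (3 - 2 * v) * (X * d⁄dX ℚ v) = 3 * v * (v - 1) := by
    linear_combination v * X * dv - (3 * X * d⁄dX ℚ v + 3 * v) * hv
  have hθG : 2 * (X * d⁄dX ℚ G) = 3 * v * (v - 1) := by
    linear_combination X * dG + hθv
  generalize X * d⁄dX ℚ G = θG at *
  have ddG := congrArg (fun f => X * d⁄dX ℚ f) hθG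
  simp only [map_sub, Derivation.leibniz, hd, smul_eq_mul, Derivation.map_one_eq_zero] at ddG
  apply mul_left_cancel₀ h3
  linear_combination (3 - 2 * v) * (2 - 54 * X ^ 3) * ddG + (2 - 54 * X ^ 3) * 3 * (2 * v - 1) * hθv
    + (3 - 2 * v) * (9 - 162 * X ^ 3) * hθG + (3 - 2 * v) * (9 - 108 * X ^ 3) * hG + 54 * hv

open PowerSeries in
theorem coeff_of_kreweras_ode {G : ℚ⟦X⟧}
    (hG : 2 * (X * d⁄dX ℚ (X * d⁄dX ℚ G)) + 9 * (X * d⁄dX ℚ G) + 9 * G =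
      54 * (X ^ 3 * (X * d⁄dX ℚ (X * d⁄dX ℚ G) + 3 * (X * d⁄dX ℚ G) + 2 * G)) + 9) (n : ℕ) :
    ((n + 1).factorial * (2 * n + 1).factorial * coeff (3 * n) G : ℚ) =
      4 ^ n * (3 * n).factorial := by
  have hθ (m : ℕ) (F : ℚ⟦X⟧) : coeff m (X * d⁄dX ℚ F) = m * coeff m F := by
    rcases m with _ | m
    · simp
    · rw [coeff_succ_X_mul, coeff_derivative]
      push_cast
      ring
  have hC (m k : ℕ) [m.AtLeastTwo] (F : ℚ⟦X⟧) :
      coeff k (OfNat.ofNat m * F) = OfNat.ofNat m * coeff k F := by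
    rw [← map_ofNat (C (R := ℚ)), coeff_C_mul]
  induction n with
  | zero =>
    have h := congrArg (coeff 0) hG
    simp only [map_add, hC, hθ] at h
    simp only [coeff_zero_eq_constantCoeff, map_ofNat, coeff_X_pow_mul'] at h
    simp at h
    simp [h]
  | succ n ih =>
    have h := congrArg (coeff (3 * n + 3)) hG
    have h9 : coeff (3 * n + 3) (9 : ℚ⟦X⟧) = 0 := by
      rw [← map_ofNat (C (R := ℚ)), coeff_succ_C]
    simp only [map_add, hC, hθ, coeff_X_pow_mul, h9] at h
    push_cast at h
    have e : 3 * (n + 1) = 3 * n + 3 := by ring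
    have e' : 2 * (n + 1) + 1 = 2 * n + 1 + 1 + 1 := by ring
    rw [e, e']
    simp only [Nat.factorial_succ (3 * n + 2), Nat.factorial_succ (3 * n + 1),
      Nat.factorial_succ (3 * n), Nat.factorial_succ (n + 1), Nat.factorial_succ (2 * n + 1),
      Nat.factorial_succ (2 * n + 1 + 1)]
    push_cast
    have h' : ((n + 2) * (2 * n + 3)) * coeff (3 * n + 3) G
        = 6 * (3 * n + 1) * (3 * n + 2) * coeff (3 * n) G := by
      linear_combination h / 9
    linear_combination (2 * n + 2) * ((n + 1).factorial * (2 * n + 1).factorial : ℚ) * h'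
      + 4 * (3 * n + 1) * (3 * n + 2) * (3 * n + 3) * ih

theorem krewerasCount_formula (n : ℕ) :
    (n + 1).factorial * (2 * n + 1).factorial * krewerasCount (3 * n) 0 0 =
      4 ^ n * (3 * n).factorial := by
  obtain ⟨v, S, c, hv, hS, h⟩ := exists_kreweras_boundary_series
  obtain ⟨Q, hQS, hQ⟩ := exists_kreweras_series h
  have := coeff_of_kreweras_ode (kreweras_ode hv hS) n
  rw [← hQS, ← PowerSeries.coeff_zero_eq_constantCoeff_apply,
    ← PowerSeries.coeff_zero_eq_constantCoeff_apply, ← krewerasCount_eq_coeff hQ] at this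
  exact_mod_cast this

/-- The number of occurrences of the letter `r` among the first `k` letters of the word `w`. -/
def letterCount {m : ℕ} (w : Fin m → Fin 3) (r : Fin 3) (k : ℕ) : ℕ :=
  (Finset.univ.filter fun v : Fin m => (v : ℕ) < k ∧ w v = r).card

/-- Every prefix of `w` contains at least as many letters `0` as letters `1`, and as letters `2`. -/
def IsBallotWord {m : ℕ} (w : Fin m → Fin 3) : Prop :=
  ∀ k, letterCount w 1 k ≤ letterCount w 0 k ∧ letterCount w 2 k ≤ letterCount w 0 k

open Classical in
/-- The ballot words of length `m` whose excess of `0`s is `i` over the `1`s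
and `j` over the `2`s. -/
noncomputable def ballotWords (m i j : ℕ) : Finset (Fin m → Fin 3) :=
  Finset.univ.filter fun w => IsBallotWord w ∧
    letterCount w 0 m = letterCount w 1 m + i ∧ letterCount w 0 m = letterCount w 2 m + j

theorem letterCount_mono {m : ℕ} (w : Fin m → Fin 3) (r : Fin 3) : Monotone (letterCount w r) := by
  intro k l hkl
  apply Finset.card_le_card
  intro v
  simp only [Finset.mem_filter, Finset.mem_univ, true_and]
  exact fun h => ⟨h.1.trans_le hkl, h.2⟩

theorem letterCount_lt {m : ℕ} (w : Fin m → Fin 3) (v : Fin m) {k : ℕ} (hk : (v : ℕ) < k) :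
    letterCount w (w v) v < letterCount w (w v) k := by
  apply Finset.card_lt_card
  refine Finset.ssubset_iff_of_subset ?_ |>.2 ⟨v, by simp [hk], by simp⟩
  intro u
  simp only [Finset.mem_filter, Finset.mem_univ, true_and]
  exact fun h => ⟨h.1.trans hk, h.2⟩

theorem letterCount_of_le {m : ℕ} (w : Fin m → Fin 3) (r : Fin 3) {k : ℕ} (hk : m ≤ k) :
    letterCount w r k = letterCount w r m := by
  unfold letterCount
  congr 1
  ext v
  simp [v.2.trans_le hk]

theorem letterCount_sum {m : ℕ} (w : Fin m → Fin 3) :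
    letterCount w 0 m + letterCount w 1 m + letterCount w 2 m = m := by
  have h := Finset.card_eq_sum_card_fiberwise (s := Finset.univ) (t := Finset.univ) (f := w)
    (by simp)
  rw [Finset.card_univ, Fintype.card_fin, Fin.sum_univ_three] at h
  simpa [letterCount] using h.symm

theorem letterCount_snoc {m : ℕ} (w : Fin m → Fin 3) (a r : Fin 3) (k : ℕ) :
    letterCount (Fin.snoc (α := fun _ => Fin 3) w a) r k =
      letterCount w r k + if m < k ∧ a = r then 1 else 0 := by
  simp only [letterCount, Finset.card_filter, Fin.sum_univ_castSucc]
  simp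

theorem isBallotWord_snoc {m : ℕ} (w : Fin m → Fin 3) (a : Fin 3) :
    IsBallotWord (Fin.snoc (α := fun _ => Fin 3) w a) ↔ IsBallotWord w ∧
      letterCount w 1 m + (if a = 1 then 1 else 0) ≤ letterCount w 0 m + (if a = 0 then 1 else 0) ∧
      letterCount w 2 m + (if a = 2 then 1 else 0) ≤
        letterCount w 0 m + (if a = 0 then 1 else 0) := by
  simp only [IsBallotWord, letterCount_snoc]
  constructor
  · intro h
    refine ⟨fun k => ?_, ?_⟩
    · rcases le_or_gt k m with hk | hk
      · simpa [hk.not_gt] using h k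
      · have := h m
        simp only [letterCount_of_le w _ hk.le]
        simpa using this
    · have := h (m + 1)
      simpa [letterCount_of_le w _ (Nat.le_succ m)] using this
  · rintro ⟨h, h'⟩ k
    rcases le_or_gt k m with hk | hk
    · simpa [hk.not_gt] using h k
    · simpa [letterCount_of_le w _ hk.le, hk] using h'

theorem card_filter_snoc {m : ℕ} (P : (Fin (m + 1) → Fin 3) → Prop) [DecidablePred P] :
    (Finset.univ.filter P).card =
      ∑ a, (Finset.univ.filter fun w => P (Fin.snoc (α := fun _ => Fin 3) w a)).card := by
  simp only [Finset.card_filter]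
  rw [← Equiv.sum_comp (Fin.snocEquiv fun _ => Fin 3), Fintype.sum_prod_type]
  rfl

theorem card_ballotWords (m i j : ℕ) : (ballotWords m i j).card = krewerasCount m i j := by
  induction m generalizing i j with
  | zero =>
    rcases i with _ | i <;> rcases j with _ | j <;>
      simp [ballotWords, krewerasCount, IsBallotWord, letterCount]
  | succ m ih =>
    have key : (ballotWords (m + 1) i j).card = (ballotWords m (i + 1) j).card
        + (ballotWords m i (j + 1)).card
        + if 1 ≤ i ∧ 1 ≤ j then (ballotWords m (i - 1) (j - 1)).card else 0 := by
      classical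
      rw [ballotWords, card_filter_snoc, Fin.sum_univ_three, add_assoc, add_comm]
      congr 1
      · congr 1 <;>
        · unfold ballotWords
          congr 1
          ext w
          simp only [Finset.mem_filter, Finset.mem_univ, true_and, isBallotWord_snoc,
            letterCount_snoc, letterCount_of_le w _ (Nat.le_succ m), and_assoc, and_congr_right_iff]
          intro hw
          have := hw m
          simp
          omega
      · split_ifs with hij
        · unfold ballotWords
          congr 1
          ext w
          simp only [Finset.mem_filter, Finset.mem_univ, true_and, isBallotWord_snoc,
            letterCount_snoc, letterCount_of_le w _ (Nat.le_succ m), and_assoc, and_congr_right_iff]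
          intro hw
          have := hw m
          simp
          omega
        · rw [Finset.card_eq_zero, Finset.filter_eq_empty_iff]
          intro w _
          simp only [isBallotWord_snoc,
            letterCount_snoc, letterCount_of_le w _ (Nat.le_succ m)]
          rintro ⟨⟨hw, -⟩, h⟩
          have := hw m
          simp at h
          omega
    rw [key]
    rcases i with _ | i <;> rcases j with _ | j <;> simp [krewerasCount, ih]

/-- The permutations counted by `ILF`, described by comparing the values at two positions. -/
theorem mem_ILF_iff {n : ℕ} (σ : Equiv.Perm (Fin (3 * n))) :
    σ ∈ (SF n).filter (fun σ => ∀ j < n - 1, lexRise n σ j) ↔ ∀ p q : Fin (3 * n),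
      ((q : ℕ) = p + 3 → σ p < σ q) ∧
      (3 ∣ (p : ℕ) → (q : ℕ) = p + 1 ∨ (q : ℕ) = p + 2 → σ p < σ q) := by
  rw [Finset.mem_filter, SF, Finset.mem_filter]
  simp only [lexRise, Finset.mem_univ, true_and]
  constructor
  · rintro ⟨h1, h2⟩ ⟨p, hp⟩ ⟨q, hq⟩
    dsimp only
    constructor
    · rintro rfl
      obtain ⟨_, a, b, c⟩ := h2 (p / 3) (by omega)
      obtain h | h | h : p % 3 = 0 ∨ p % 3 = 1 ∨ p % 3 = 2 := by omega
      · convert a using 3 <;> omega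
      · convert b using 3 <;> omega
      · convert c using 3 <;> omega
    · rintro ⟨j, rfl⟩ (rfl | rfl)
      · obtain ⟨_, a, -⟩ := h1 j (by omega)
        exact a
      · obtain ⟨_, -, a⟩ := h1 j (by omega)
        exact a
  · intro h
    refine ⟨fun j hj => ⟨by omega, ?_, ?_⟩, fun j hj => ⟨by omega, ?_, ?_, ?_⟩⟩
    · exact (h _ _).2 ⟨j, rfl⟩ (Or.inl rfl)
    · exact (h _ _).2 ⟨j, rfl⟩ (Or.inr rfl)
    all_goals exact (h _ _).1 rfl

/-- The word recording the residue mod `3` of the position of each value of `σ`. -/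
def residueWord {n : ℕ} (σ : Equiv.Perm (Fin (3 * n))) (v : Fin (3 * n)) : Fin 3 :=
  ⟨(σ.symm v : ℕ) % 3, Nat.mod_lt _ (by norm_num)⟩

theorem letterCount_residueWord {n : ℕ} (σ : Equiv.Perm (Fin (3 * n))) (r : Fin 3) (k : ℕ) :
    letterCount (residueWord σ) r k =
      (Finset.univ.filter fun p => (σ p : ℕ) < k ∧ (p : ℕ) % 3 = r).card := by
  refine Finset.card_nbij' σ.symm σ ?_ ?_ ?_ ?_ <;>
    simp +contextual [residueWord, Set.MapsTo, Set.LeftInvOn, Fin.ext_iff]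

theorem card_filter_mod_three {n j r : ℕ} (hj : j ≤ n) (hr : r < 3) :
    (Finset.univ.filter fun p : Fin (3 * n) => (p : ℕ) < 3 * j + r ∧ (p : ℕ) % 3 = r).card
      = j := by
  conv_rhs => rw [← Finset.card_range j]
  refine Finset.card_bij (fun p _ => (p : ℕ) / 3) ?_ ?_ ?_
  · simp only [Finset.mem_filter, Finset.mem_univ, true_and, Finset.mem_range]
    intros
    omega
  · simp only [Finset.mem_filter, Finset.mem_univ, true_and, Fin.ext_iff]
    intros
    omega
  · simp only [Finset.mem_filter, Finset.mem_univ, true_and, Finset.mem_range]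
    intro i hi
    exact ⟨⟨3 * i + r, by omega⟩, by dsimp only; omega, by dsimp only; omega⟩

theorem lt_of_mod_three_eq {n : ℕ} {σ : Equiv.Perm (Fin (3 * n))}
    (hσ : ∀ p q : Fin (3 * n), (q : ℕ) = p + 3 → σ p < σ q) {p q : Fin (3 * n)}
    (hmod : (p : ℕ) % 3 = (q : ℕ) % 3) (hpq : p < q) : σ p < σ q := by
  obtain ⟨d, hd⟩ : ∃ d, (q : ℕ) = p + 3 * (d + 1) := ⟨((q : ℕ) - p) / 3 - 1, by omega⟩
  induction d generalizing q with
  | zero => exact hσ p q hd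
  | succ d ih =>
    have hq := q.2
    let q' : Fin (3 * n) := ⟨p + 3 * (d + 1), by omega⟩
    have hq' : (q' : ℕ) = p + 3 * (d + 1) := rfl
    exact (ih (q := q') (by omega) (by omega) hq').trans (hσ q' q (by omega))

theorem letterCount_residueWord_apply {n : ℕ} {σ : Equiv.Perm (Fin (3 * n))}
    (hσ : ∀ p q : Fin (3 * n), (q : ℕ) = p + 3 → σ p < σ q) (v : Fin (3 * n)) :
    letterCount (residueWord σ) (residueWord σ v) v = (σ.symm v : ℕ) / 3 := by
  obtain ⟨p, rfl⟩ := σ.surjective v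
  have hp := p.2
  rw [letterCount_residueWord, σ.symm_apply_apply,
    ← card_filter_mod_three (n := n) (j := p / 3) (r := p % 3) (by omega) (by omega)]
  congr 1
  ext q
  simp only [residueWord, Finset.mem_filter, Finset.mem_univ, true_and, σ.symm_apply_apply,
    and_congr_left_iff]
  intro hmod
  rw [Nat.div_add_mod, Fin.val_fin_lt, Fin.val_fin_lt]
  refine ⟨fun h => ?_, lt_of_mod_three_eq hσ hmod⟩
  by_contra! hqp
  rcases hqp.eq_or_lt with rfl | hlt
  · exact lt_irrefl _ h
  · exact lt_asymm h (lt_of_mod_three_eq hσ hmod.symm hlt)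

theorem residueWord_mem_ballotWords {n : ℕ} {σ : Equiv.Perm (Fin (3 * n))}
    (hσ : σ ∈ (SF n).filter (fun σ => ∀ j < n - 1, lexRise n σ j)) :
    residueWord σ ∈ ballotWords (3 * n) 0 0 := by
  rw [mem_ILF_iff] at hσ
  have htotal (r : Fin 3) : letterCount (residueWord σ) r (3 * n) = n := by
    rw [letterCount_residueWord]
    conv_rhs => rw [← card_filter_mod_three (le_refl n) r.2]
    congr 1
    ext p
    have := (σ p).2
    simp
    omega
  have hprefix (r : Fin 3) (hr : r ≠ 0) (k : ℕ) :
      letterCount (residueWord σ) r k ≤ letterCount (residueWord σ) 0 k := by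
    rw [letterCount_residueWord, letterCount_residueWord]
    refine Finset.card_le_card_of_injOn (fun p => ⟨p - r, by omega⟩) ?_ ?_
    · intro p
      simp only [Finset.coe_filter, Finset.mem_univ, true_and, Set.mem_ofPred_eq]
      rintro ⟨hk, hp⟩
      have h0 : ((0 : Fin 3) : ℕ) = 0 := rfl
      have := (hσ ⟨p - r, by omega⟩ p).2 (by dsimp only; omega) (by dsimp only; omega)
      exact ⟨(Fin.lt_def.1 this).trans hk, by omega⟩
    · intro p hp q hq
      simp only [Finset.coe_filter, Finset.mem_univ, true_and, Set.mem_ofPred_eq] at hp hq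
      simp only [Fin.ext_iff]
      omega
  simp only [ballotWords, Finset.mem_filter, Finset.mem_univ, true_and, htotal]
  exact ⟨fun k => ⟨hprefix 1 (by decide) k, hprefix 2 (by decide) k⟩, by simp⟩

theorem exists_residueWord_eq {n : ℕ} {w : Fin (3 * n) → Fin 3}
    (hw : w ∈ ballotWords (3 * n) 0 0) :
    ∃ σ ∈ (SF n).filter (fun σ => ∀ j < n - 1, lexRise n σ j), residueWord σ = w := by
  simp only [ballotWords, Finset.mem_filter, Finset.mem_univ, true_and] at hw
  obtain ⟨hballot, h1, h2⟩ := hw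
  have hsum := letterCount_sum w
  have htotal (r : Fin 3) : letterCount w r (3 * n) = n := by
    fin_cases r <;> simp <;> omega
  have hlt (v : Fin (3 * n)) : letterCount w (w v) v < n :=
    (letterCount_lt w v v.2).trans_eq (htotal _)
  let f (v : Fin (3 * n)) : Fin (3 * n) :=
    ⟨3 * letterCount w (w v) v + w v, by have := hlt v; omega⟩
  have hf (v : Fin (3 * n)) : (f v : ℕ) = 3 * letterCount w (w v) v + w v := rfl
  have hinj : Function.Injective f := by
    intro u v huv
    have huv' := congrArg Fin.val huv
    rw [hf, hf] at huv'
    have hletter : w u = w v := Fin.ext (by omega)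
    rw [hletter] at huv'
    rcases lt_trichotomy (u : ℕ) v with h | h | h
    · have := letterCount_lt w u h
      rw [hletter] at this
      omega
    · exact Fin.ext h
    · have := letterCount_lt w v h
      omega
  let e := Equiv.ofBijective f (Finite.injective_iff_bijective.1 hinj)
  refine ⟨e.symm, (mem_ILF_iff _).2 fun p q => ?_, ?_⟩
  · obtain ⟨u, rfl⟩ := e.surjective p
    obtain ⟨v, rfl⟩ := e.surjective q
    rw [e.symm_apply_apply, e.symm_apply_apply]
    change ((f v : ℕ) = f u + 3 → _) ∧
      (3 ∣ (f u : ℕ) → (f v : ℕ) = f u + 1 ∨ (f v : ℕ) = f u + 2 → _)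
    rw [hf, hf]
    constructor
    · intro h
      have hletter : w u = w v := Fin.ext (by omega)
      by_contra! hvu
      have := letterCount_mono w (w v) (Fin.le_def.1 hvu)
      rw [hletter] at h
      omega
    · intro h h'
      have hu : w u = 0 := Fin.ext (by simp; omega)
      have hv : w v = 1 ∨ w v = 2 := by simp only [Fin.ext_iff]; simp; omega
      have hne : v ≠ u := by
        rintro rfl
        simp [hu] at hv
      by_contra! hvu
      have hlt' : (v : ℕ) < u := lt_of_le_of_ne hvu (Fin.val_ne_of_ne hne)
      have a := letterCount_lt w v (Nat.lt_add_one (v : ℕ))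
      have b := letterCount_mono w 0 (Nat.add_one_le_iff.2 hlt')
      have c := hballot (v + 1)
      rcases hv with hv | hv <;> rw [hu, hv] at h' <;> rw [hv] at a <;> simp at h' <;> omega
  · funext v
    apply Fin.ext
    change (f v : ℕ) % 3 = w v
    rw [hf]
    omega

theorem ILF_eq_krewerasCount (n : ℕ) : ILF n = krewerasCount (3 * n) 0 0 := by
  rw [← card_ballotWords, ILF]
  refine Finset.card_bij (fun σ _ => residueWord σ) (fun σ => residueWord_mem_ballotWords) ?_ ?_
  · intro σ hσ τ hτ h
    rw [mem_ILF_iff] at hσ hτ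
    have hσ' := letterCount_residueWord_apply fun p q => (hσ p q).1
    have hτ' := letterCount_residueWord_apply fun p q => (hτ p q).1
    apply Equiv.symm_bijective.injective
    ext v
    have hmod := congrArg Fin.val (congrFun h v)
    have hdiv := hσ' v
    rw [h, hτ' v] at hdiv
    simp only [residueWord] at hmod
    omega
  · intro w hw
    obtain ⟨σ, hσ, rfl⟩ := exists_residueWord_eq hw
    exact ⟨σ, hσ, rfl⟩

theorem ILF_eq (n : ℕ) (hn : 1 ≤ n) :
    (n + 1).factorial * (2 * n + 1).factorial * ILF n = 4 ^ n * (3 * n).factorial := by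
  rw [ILF_eq_krewerasCount, krewerasCount_formula]
end

section
/- For every n ≥ 1, LB_n = LE_n + Σ_{k=1}^{n} C(3n+1, 3k−1) · LB_{k−1} · LB_{n−k}, where C(m,r) denotes the binomial coefficient. -/
/-- `LAcount n`: linear extensions of the poset `A_n` — permutations `σ` of `{1,…,3n}`
(modeled 0-based on `Fin (3n)`) with `σ(3i+1) < σ(3i+2)`, `σ(3i+1) < σ(3i+3)` for
`0 ≤ i ≤ n-1` and `σ(3i) < σ(3i+2)` for `1 ≤ i ≤ n-1` (1-based positions). -/
def LAset (n : ℕ) : Finset (Equiv.Perm (Fin (3*n))) :=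
  Finset.univ.filter fun σ =>
    (∀ i < n, ∃ h : 3*i+2 < 3*n,
        σ ⟨3*i, by omega⟩ < σ ⟨3*i+1, by omega⟩ ∧ σ ⟨3*i, by omega⟩ < σ ⟨3*i+2, h⟩) ∧
    (∀ i < n, 1 ≤ i → ∃ h : 3*i+1 < 3*n, σ ⟨3*i-1, by omega⟩ < σ ⟨3*i+1, h⟩)

def LAcount (n : ℕ) : ℕ := (LAset n).card

/-- `LEcount n`: linear extensions of `E_n` — permutations of `{1,…,3n+1}` with the `A_n`
constraints together with `σ(3n) < σ(3n+1)` (1-based positions). -/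
def LEset (n : ℕ) : Finset (Equiv.Perm (Fin (3*n+1))) :=
  Finset.univ.filter fun σ =>
    (∀ i < n, ∃ h : 3*i+2 < 3*n+1,
        σ ⟨3*i, by omega⟩ < σ ⟨3*i+1, by omega⟩ ∧ σ ⟨3*i, by omega⟩ < σ ⟨3*i+2, h⟩) ∧
    (∀ i < n, 1 ≤ i → ∃ h : 3*i+1 < 3*n+1, σ ⟨3*i-1, by omega⟩ < σ ⟨3*i+1, h⟩) ∧
    (∀ _h : 1 ≤ n, σ ⟨3*n-1, by omega⟩ < σ ⟨3*n, by omega⟩)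

def LEcount (n : ℕ) : ℕ := (LEset n).card

/-- `LScount n`: linear extensions of `S_n` — permutations of `{1,…,3n+1}` with
`σ(3i+2) < σ(3i+3)`, `σ(3i+2) < σ(3i+4)` for `0 ≤ i ≤ n-1`, `σ(3i+1) < σ(3i+3)` for
`1 ≤ i ≤ n-1`, and `σ(1) < σ(3)` (1-based positions). -/
def LSset (n : ℕ) : Finset (Equiv.Perm (Fin (3*n+1))) :=
  Finset.univ.filter fun σ =>
    (∀ i < n, ∃ h : 3*i+3 < 3*n+1,
        σ ⟨3*i+1, by omega⟩ < σ ⟨3*i+2, by omega⟩ ∧ σ ⟨3*i+1, by omega⟩ < σ ⟨3*i+3, h⟩) ∧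
    (∀ i < n, 1 ≤ i → ∃ h : 3*i+2 < 3*n+1, σ ⟨3*i, by omega⟩ < σ ⟨3*i+2, h⟩) ∧
    (∀ _h : 1 ≤ n, σ ⟨0, by omega⟩ < σ ⟨2, by omega⟩)

def LScount (n : ℕ) : ℕ := (LSset n).card

/-- `LBcount n`: linear extensions of `B_n` — permutations of `{1,…,3n+2}` with the `S_n`
constraints together with `σ(3n+1) < σ(3n+2)` (1-based positions). -/
def LBset (n : ℕ) : Finset (Equiv.Perm (Fin (3*n+2))) :=
  Finset.univ.filter fun σ =>
    (∀ i < n, ∃ h : 3*i+3 < 3*n+2,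
        σ ⟨3*i+1, by omega⟩ < σ ⟨3*i+2, by omega⟩ ∧ σ ⟨3*i+1, by omega⟩ < σ ⟨3*i+3, h⟩) ∧
    (∀ i < n, 1 ≤ i → ∃ h : 3*i+2 < 3*n+2, σ ⟨3*i, by omega⟩ < σ ⟨3*i+2, h⟩) ∧
    (∀ _h : 1 ≤ n, σ ⟨0, by omega⟩ < σ ⟨2, by omega⟩) ∧
    σ ⟨3*n, by omega⟩ < σ ⟨3*n+1, by omega⟩

def LBcount (n : ℕ) : ℕ := (LBset n).card

/-- The word `l` has its descents exactly at the (0-based) indices satisfying `D`. -/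
def HasDescents {α : Type*} [LinearOrder α] (D : ℕ → Prop) (l : List α) : Prop :=
  ∀ (i : ℕ) (h : i + 1 < l.length), l[i + 1] < l[i] ↔ D i

open Classical in
/-- The words using each letter of `S` exactly once, with descents exactly at `D`. -/
noncomputable def descentWords {α : Type*} [LinearOrder α] (D : ℕ → Prop) (S : Finset α) :
    Finset (List α) :=
  S.toList.permutations.toFinset.filter (HasDescents D)

open Classical in
/-- The permutations of `Fin m` with descents exactly at `D`. -/
noncomputable def descentPerms (D : ℕ → Prop) (m : ℕ) : Finset (Equiv.Perm (Fin m)) :=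
  Finset.univ.filter fun σ =>
    ∀ (i : ℕ) (h : i + 1 < m), σ ⟨i + 1, h⟩ < σ ⟨i, by omega⟩ ↔ D i

theorem mem_descentPerms {D : ℕ → Prop} {m : ℕ} {σ : Equiv.Perm (Fin m)} :
    σ ∈ descentPerms D m ↔
      ∀ (i : ℕ) (h : i + 1 < m), σ ⟨i + 1, h⟩ < σ ⟨i, by omega⟩ ↔ D i := by
  simp [descentPerms]

theorem mem_descentPerms' {D : ℕ → Prop} {m : ℕ} {σ : Equiv.Perm (Fin m)} :
    σ ∈ descentPerms D m ↔ ∀ (i : ℕ) (h : i + 1 < m),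
      (D i → σ ⟨i + 1, h⟩ < σ ⟨i, by omega⟩) ∧ (¬ D i → σ ⟨i, by omega⟩ < σ ⟨i + 1, h⟩) := by
  rw [mem_descentPerms]
  refine forall₂_congr fun i h => ?_
  have hne : σ ⟨i, by omega⟩ ≠ σ ⟨i + 1, h⟩ := fun he => by simpa using σ.injective he
  rcases lt_or_gt_of_ne hne with hlt | hlt <;> have := hlt.not_gt <;> tauto

section Words

variable {α : Type*} [LinearOrder α] {D : ℕ → Prop}

theorem mem_descentWords {S : Finset α} {l : List α} :
    l ∈ descentWords D S ↔ l.Nodup ∧ l.toFinset = S ∧ HasDescents D l := by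
  simp only [descentWords, Finset.mem_filter, List.mem_toFinset, List.mem_permutations,
    ← and_assoc, and_congr_left_iff]
  intro _
  constructor
  · intro h
    exact ⟨h.nodup_iff.2 S.nodup_toList, by rw [List.toFinset_eq_of_perm _ _ h, S.toList_toFinset]⟩
  · rintro ⟨h, rfl⟩
    exact (List.toFinset_toList h).symm

theorem length_of_mem_descentWords {S : Finset α} {l : List α} (h : l ∈ descentWords D S) :
    l.length = S.card := by
  obtain ⟨hl, rfl, -⟩ := mem_descentWords.1 h
  exact (List.toFinset_card_of_nodup hl).symm

theorem card_descentWords (D : ℕ → Prop) (S : Finset α) :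
    (descentWords D S).card = (descentPerms D S.card).card := by
  symm
  refine Finset.card_bij
    (fun σ _ => List.ofFn fun i => S.orderEmbOfFin rfl (σ i)) ?_ ?_ ?_
  · intro σ hσ
    rw [mem_descentPerms] at hσ
    refine mem_descentWords.2 ⟨?_, ?_, ?_⟩
    · exact List.nodup_ofFn.2 ((S.orderEmbOfFin rfl).injective.comp σ.injective)
    · ext x
      have hx := Set.ext_iff.1 (S.range_orderEmbOfFin rfl) x
      simp only [Set.mem_range, Finset.mem_coe] at hx
      simp only [List.mem_toFinset, List.mem_ofFn, ← hx]
      exact ⟨fun ⟨i, hi⟩ => ⟨σ i, hi⟩, fun ⟨i, hi⟩ => ⟨σ.symm i, by simpa using hi⟩⟩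
    · intro i h
      simpa using hσ i (by simpa using h)
  · intro σ _ τ _ h
    ext1 i
    exact (S.orderEmbOfFin rfl).injective (congrFun (List.ofFn_injective h) i)
  · intro l hl
    have hlen := length_of_mem_descentWords hl
    obtain ⟨hnd, hS, hD⟩ := mem_descentWords.1 hl
    have hmem : ∀ i : Fin S.card, l[i.1]'(by omega) ∈ S := fun i => by
      simp [← hS]
    let e := S.orderIsoOfFin rfl
    let f : Fin S.card → Fin S.card := fun i => e.symm ⟨l[i.1]'(by omega), hmem i⟩
    have hf : Function.Injective f := by
      intro i j hij
      have := e.symm.injective hij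
      rw [Subtype.mk.injEq, hnd.getElem_inj_iff] at this
      exact Fin.ext this
    have hef : ∀ i, S.orderEmbOfFin rfl (f i) = l[i.1]'(by omega) := fun i => by
      rw [← Finset.coe_orderIsoOfFin_apply]
      simp [f, e]
    refine ⟨Equiv.ofBijective f (Finite.injective_iff_bijective.1 hf), ?_, ?_⟩
    · refine mem_descentPerms.2 fun i h => ?_
      rw [← hD i (by omega), Equiv.ofBijective_apply, Equiv.ofBijective_apply,
        ← (S.orderEmbOfFin rfl).lt_iff_lt, hef, hef]
    · refine List.ext_getElem (by simp [hlen]) fun i _ _ => ?_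
      simp [hef]

theorem hasDescents_append_cons {a : α} {u v : List α} (hu : ∀ x ∈ u, a < x)
    (hv : ∀ x ∈ v, a < x) :
    HasDescents D (u ++ a :: v) ↔
      HasDescents D u ∧ HasDescents (fun i => D (i + u.length + 1)) v ∧
        (u.length ≠ 0 → D (u.length - 1)) ∧ (v.length ≠ 0 → ¬ D u.length) := by
  constructor
  · intro h
    refine ⟨fun i hi => ?_, fun i hi => ?_, fun h0 => ?_, fun h0 => ?_⟩
    · rw [← h i (by simp; omega), List.getElem_append_left (by omega),
        List.getElem_append_left (by omega)]
    · have := h (i + u.length + 1) (by simp; omega)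
      rw [List.getElem_append_right (by omega), List.getElem_append_right (by omega)] at this
      simpa [show i + u.length + 1 + 1 - u.length = i + 1 + 1 by omega,
        show i + u.length + 1 - u.length = i + 1 by omega] using this
    · rw [← h (u.length - 1) (by simp; omega), List.getElem_append_left (by omega : u.length - 1 < _),
        List.getElem_append_right (by omega)]
      simp [show u.length - 1 + 1 - u.length = 0 by omega]
      exact hu _ (List.getElem_mem _)
    · rw [← h u.length (by simp; omega), List.getElem_append_right (by omega),
        List.getElem_append_right (by omega)]
      simp only [Nat.add_sub_cancel_left, Nat.sub_self, List.getElem_cons_succ,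
        List.getElem_cons_zero, not_lt]
      exact (hv _ (List.getElem_mem _)).le
  · rintro ⟨h1, h2, h3, h4⟩ i hi
    simp only [List.length_append, List.length_cons] at hi
    rcases lt_trichotomy (i + 1) u.length with h | h | h
    · rw [← h1 i h, List.getElem_append_left (by omega), List.getElem_append_left (by omega)]
    · rw [List.getElem_append_left (by omega : i < _), List.getElem_append_right (by omega)]
      have := h3 (by omega)
      rw [show u.length - 1 = i by omega] at this
      simp only [show i + 1 - u.length = 0 by omega, List.getElem_cons_zero, this, iff_true]
      exact hu _ (List.getElem_mem _)
    · obtain ⟨j, rfl⟩ := Nat.exists_eq_add_of_le (Nat.lt_succ_iff.1 h)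
      rw [List.getElem_append_right (by omega), List.getElem_append_right (by omega)]
      rcases j with _ | j
      · simp only [Nat.add_zero, Nat.add_sub_cancel_left, Nat.sub_self, List.getElem_cons_succ,
          List.getElem_cons_zero, h4 (by omega), iff_false, not_lt]
        exact (hv _ (List.getElem_mem _)).le
      · have := h2 j (by omega)
        simp only [show u.length + (j + 1) = j + u.length + 1 by omega,
          show j + u.length + 1 + 1 - u.length = j + 1 + 1 by omega,
          show j + u.length + 1 - u.length = j + 1 by omega, List.getElem_cons_succ, this]

/-- Splitting a word at its least letter `a`, the letters to the left of `a` forming a set `T`. -/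
theorem card_descentWords_insert (D : ℕ → Prop) [DecidablePred D] {a : α} {S : Finset α}
    (ha : ∀ x ∈ S, a < x) :
    (descentWords D (insert a S)).card = ∑ T ∈ S.powerset,
      if (T.card ≠ 0 → D (T.card - 1)) ∧ (S.card - T.card ≠ 0 → ¬ D T.card) then
        (descentWords D T).card *
          (descentWords (fun i => D (i + T.card + 1)) (S \ T)).card
      else 0 := by
  rw [← Finset.sum_filter]
  simp_rw [← Finset.card_product]
  rw [← Finset.card_sigma]
  symm
  refine Finset.card_bij (fun p _ => p.2.1 ++ a :: p.2.2) ?_ ?_ ?_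
  · rintro ⟨T, u, v⟩ h
    simp only [Finset.mem_sigma, Finset.mem_filter, Finset.mem_powerset, Finset.mem_product] at h
    obtain ⟨⟨hT, hl, hr⟩, hu, hv⟩ := h
    have lu := length_of_mem_descentWords hu
    have lv := length_of_mem_descentWords hv
    rw [Finset.card_sdiff_of_subset hT] at lv
    obtain ⟨nu, rfl, du⟩ := mem_descentWords.1 hu
    obtain ⟨nv, hvS, dv⟩ := mem_descentWords.1 hv
    have hu' : ∀ x ∈ u, x ∈ S := fun x hx => hT (by simpa using hx)
    have hv' : ∀ x ∈ v, x ∈ S ∧ x ∉ u := fun x hx => by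
      have := List.mem_toFinset.2 hx
      rw [hvS] at this
      simpa using this
    refine mem_descentWords.2 ⟨?_, ?_, ?_⟩
    · rw [List.nodup_append, List.nodup_cons]
      refine ⟨nu, ⟨fun h => (ha a (hv' a h).1).false, nv⟩, ?_⟩
      rintro x hx y hy rfl
      rcases List.mem_cons.1 hy with rfl | hy
      · exact (ha x (hu' x hx)).false
      · exact (hv' x hy).2 hx
    · rw [List.toFinset_append, List.toFinset_cons, hvS, Finset.union_insert,
        Finset.union_sdiff_of_subset hT]
    · rw [hasDescents_append_cons (fun x hx => ha x (hu' x hx)) (fun x hx => ha x (hv' x hx).1)]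
      rw [← lu] at hl hr dv lv
      rw [← lv] at hr
      exact ⟨du, dv, hl, hr⟩
  · rintro ⟨T, u, v⟩ h ⟨T', u', v'⟩ h' huv
    simp only [Finset.mem_sigma, Finset.mem_filter, Finset.mem_powerset, Finset.mem_product] at h h'
    obtain ⟨-, rfl, -⟩ := mem_descentWords.1 h.2.1
    obtain ⟨-, rfl, -⟩ := mem_descentWords.1 h'.2.1
    have hu : a ∉ u := fun hx => (ha a (h.1.1 (by simpa using hx))).false
    have hu' : a ∉ u' := fun hx => (ha a (h'.1.1 (by simpa using hx))).false
    have key : u = u' ∧ v = v' := by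
      have hi := congrArg (List.idxOf a) huv
      simp only [List.idxOf_append_of_notMem hu, List.idxOf_append_of_notMem hu',
        List.idxOf_cons_self, Nat.add_zero] at hi
      have := List.append_inj huv hi
      simpa using this
    obtain ⟨rfl, rfl⟩ := key
    rfl
  · intro l hl
    obtain ⟨nl, hS, dl⟩ := mem_descentWords.1 hl
    have hal : a ∈ l := by
      rw [← List.mem_toFinset, hS]
      exact Finset.mem_insert_self _ _
    obtain ⟨u, v, rfl⟩ := List.append_of_mem hal
    rw [List.nodup_append, List.nodup_cons] at nl
    obtain ⟨nu, ⟨nav, nv⟩, nuv⟩ := nl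
    have nau : a ∉ u := fun h => nuv a h a (by simp) rfl
    have hmem : ∀ x, x ∈ S ↔ x ∈ u ∨ x ∈ v := by
      intro x
      have h := Finset.ext_iff.1 hS x
      simp only [List.mem_toFinset, List.mem_append, List.mem_cons, Finset.mem_insert] at h
      have haS : a ∉ S := fun h => (ha a h).false
      by_cases hx : x = a
      · subst hx
        simp [haS, nau, nav]
      · simpa [hx] using h.symm
    have hT : u.toFinset ⊆ S := fun x hx => (hmem x).2 (Or.inl (by simpa using hx))
    have hvS : v.toFinset = S \ u.toFinset := by
      ext x
      have := hmem x
      have : x ∈ v → x ∉ u := fun hx hy => nuv x hy x (by simp [hx]) rfl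
      simp only [List.mem_toFinset, Finset.mem_sdiff]
      tauto
    have lu := List.toFinset_card_of_nodup nu
    have lv := List.toFinset_card_of_nodup nv
    rw [hvS, Finset.card_sdiff_of_subset hT] at lv
    obtain ⟨du, dv, h3, h4⟩ := (hasDescents_append_cons
      (fun x hx => ha x ((hmem x).2 (Or.inl hx)))
      (fun x hx => ha x ((hmem x).2 (Or.inr hx)))).1 dl
    refine ⟨⟨u.toFinset, u, v⟩, ?_, rfl⟩
    simp only [Finset.mem_sigma, Finset.mem_filter, Finset.mem_powerset, Finset.mem_product,
      mem_descentWords, lu]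
    rw [lu] at lv
    exact ⟨⟨hT, h3, lv ▸ h4⟩, ⟨nu, trivial, du⟩, nv, hvS, dv⟩

end Words

/-- Recursion for permutations with a given descent set, by the position of the least value. -/
theorem card_descentPerms_succ (D : ℕ → Prop) [DecidablePred D] (m : ℕ) :
    (descentPerms D (m + 1)).card = ∑ j ∈ Finset.range (m + 1), m.choose j *
      if (j ≠ 0 → D (j - 1)) ∧ (m - j ≠ 0 → ¬ D j) then
        (descentPerms D j).card * (descentPerms (fun i => D (i + j + 1)) (m - j)).card
      else 0 := by
  have hS : (Finset.Icc 1 m).card = m := by simp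
  have h0 : ∀ x ∈ Finset.Icc 1 m, 0 < x := fun x hx => (Finset.mem_Icc.1 hx).1
  have h := card_descentWords_insert D h0
  rw [card_descentWords, Finset.card_insert_of_notMem (by simp), hS] at h
  have hsum := Finset.sum_powerset_apply_card (fun j =>
      if (j ≠ 0 → D (j - 1)) ∧ (m - j ≠ 0 → ¬ D j) then
        (descentPerms D j).card * (descentPerms (fun i => D (i + j + 1)) (m - j)).card
      else 0) (x := Finset.Icc 1 m)
  rw [hS] at hsum
  simp only [smul_eq_mul] at hsum
  rw [h, ← hsum]
  refine Finset.sum_congr rfl fun T hT => ?_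
  rw [card_descentWords, card_descentWords,
    Finset.card_sdiff_of_subset (Finset.mem_powerset.1 hT), hS]

/-- The involution of `ℕ` exchanging `3 * i + c` and `3 * i + c + 1` where both are below `m`. -/
def swapIdx (c m j : ℕ) : ℕ :=
  if j % 3 = c % 3 ∧ j + 1 < m then j + 1
  else if j % 3 = (c + 1) % 3 ∧ 1 ≤ j then j - 1 else j

theorem swapIdx_lt {c m j : ℕ} (h : j < m) : swapIdx c m j < m := by
  unfold swapIdx
  split_ifs <;> omega

theorem swapIdx_swapIdx {c m j : ℕ} (h : j < m) : swapIdx c m (swapIdx c m j) = j := by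
  unfold swapIdx
  split_ifs <;> omega

/-- `swapIdx` as a permutation of `Fin m`. -/
def swapPairs (c m : ℕ) : Equiv.Perm (Fin m) :=
  Function.Involutive.toPerm (fun j => ⟨swapIdx c m j, swapIdx_lt j.2⟩)
    fun j => Fin.ext (swapIdx_swapIdx j.2)

theorem mul_swapPairs_apply {c m j k : ℕ} (σ : Equiv.Perm (Fin m)) (hj : j < m)
    (hk : swapIdx c m j = k) :
    (σ * swapPairs c m) ⟨j, hj⟩ = σ ⟨k, hk ▸ swapIdx_lt hj⟩ := by
  subst hk
  rfl

theorem LBcount_eq_card_descentPerms (n : ℕ) :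
    LBcount n = (descentPerms (fun i => i % 3 = 1) (3 * n + 2)).card := by
  refine Finset.card_equiv (Equiv.mulRight (swapPairs 1 (3 * n + 2))) fun σ => ?_
  have e0 (i : ℕ) (h : 3 * i < 3 * n + 2) :=
    mul_swapPairs_apply (c := 1) (k := 3 * i) σ h (by unfold swapIdx; split_ifs <;> omega)
  have e1 (i : ℕ) (h : 3 * i + 1 < 3 * n + 2) (hi : i < n) :=
    mul_swapPairs_apply (c := 1) (k := 3 * i + 2) σ h (by unfold swapIdx; split_ifs <;> omega)
  have e2 (i : ℕ) (h : 3 * i + 2 < 3 * n + 2) :=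
    mul_swapPairs_apply (c := 1) (k := 3 * i + 1) σ h (by unfold swapIdx; split_ifs <;> omega)
  have e3 := mul_swapPairs_apply (c := 1) (k := 3 * n + 1) (j := 3 * n + 1) σ (by omega)
    (by unfold swapIdx; split_ifs <;> omega)
  rw [Equiv.coe_mulRight, mem_descentPerms', LBset, Finset.mem_filter]
  constructor
  · rintro ⟨-, h1, h2, h3, h4⟩ j hj
    obtain ⟨i, rfl | rfl | rfl⟩ : ∃ i, j = 3 * i ∨ j = 3 * i + 1 ∨ j = 3 * i + 2 :=
      ⟨j / 3, by omega⟩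
    · refine ⟨fun h => by omega, fun _ => ?_⟩
      rw [e0]
      obtain hi | rfl : i < n ∨ i = n := by omega
      · rw [e1 _ _ hi]
        rcases Nat.eq_zero_or_pos i with rfl | hi0
        · exact h3 hi
        · exact (h2 i hi hi0).2
      · rw [e3]
        exact h4
    · have hi : i < n := by omega
      refine ⟨fun _ => ?_, fun h => by omega⟩
      rw [e1 _ _ hi, e2]
      exact (h1 i hi).2.1
    · have hi : i < n := by omega
      refine ⟨fun h => by omega, fun _ => ?_⟩
      rw [e2]
      exact (e0 (i + 1) (by omega)).symm ▸ (h1 i hi).2.2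
  · intro h
    have a0 (i : ℕ) (hi : i < n) : σ ⟨3 * i, by omega⟩ < σ ⟨3 * i + 2, by omega⟩ := by
      have := (h (3 * i) (by omega)).2 (by omega)
      rwa [e0, e1 _ _ hi] at this
    refine ⟨Finset.mem_univ _, fun i hi => ⟨by omega, ?_, ?_⟩, fun i hi _ => ⟨by omega, a0 i hi⟩,
      fun hn => a0 0 hn, ?_⟩
    · have := (h (3 * i + 1) (by omega)).1 (by omega)
      rwa [e1 _ _ hi, e2] at this
    · have := (h (3 * i + 2) (by omega)).2 (by omega)
      rw [e2] at this
      exact e0 (i + 1) (by omega) ▸ this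
    · have := (h (3 * n) (by omega)).2 (by omega)
      rwa [e0, e3] at this

theorem LEcount_eq_card_descentPerms (n : ℕ) :
    LEcount n = (descentPerms (fun i => i % 3 = 0) (3 * n + 1)).card := by
  refine Finset.card_equiv (Equiv.mulRight (swapPairs 0 (3 * n + 1))) fun σ => ?_
  have e0 (i : ℕ) (h : 3 * i < 3 * n + 1) (hi : i < n) :=
    mul_swapPairs_apply (c := 0) (k := 3 * i + 1) σ h (by unfold swapIdx; split_ifs <;> omega)
  have e1 (i : ℕ) (h : 3 * i + 1 < 3 * n + 1) :=
    mul_swapPairs_apply (c := 0) (k := 3 * i) σ h (by unfold swapIdx; split_ifs <;> omega)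
  have e2 (i : ℕ) (h : 3 * i + 2 < 3 * n + 1) :=
    mul_swapPairs_apply (c := 0) (k := 3 * i + 2) σ h (by unfold swapIdx; split_ifs <;> omega)
  have e3 := mul_swapPairs_apply (c := 0) (k := 3 * n) (j := 3 * n) σ (by omega)
    (by unfold swapIdx; split_ifs <;> omega)
  rw [Equiv.coe_mulRight, mem_descentPerms', LEset, Finset.mem_filter]
  constructor
  · rintro ⟨-, h1, h2, h3⟩ j hj
    obtain ⟨i, rfl | rfl | rfl⟩ : ∃ i, j = 3 * i ∨ j = 3 * i + 1 ∨ j = 3 * i + 2 :=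
      ⟨j / 3, by omega⟩
    · have hi : i < n := by omega
      refine ⟨fun _ => ?_, fun h => by omega⟩
      rw [e0 _ _ hi, e1]
      exact (h1 i hi).2.1
    · have hi : i < n := by omega
      refine ⟨fun h => by omega, fun _ => ?_⟩
      rw [e1, e2]
      exact (h1 i hi).2.2
    · refine ⟨fun h => by omega, fun _ => ?_⟩
      rw [e2]
      obtain hi | rfl : i + 1 < n ∨ n = i + 1 := by omega
      · exact (e0 (i + 1) (by omega) hi).symm ▸ (h2 (i + 1) hi (by omega)).2
      · exact e3.symm ▸ h3 (by omega)
  · intro h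
    refine ⟨Finset.mem_univ _, fun i hi => ⟨by omega, ?_, ?_⟩, fun i hi hi0 => ⟨by omega, ?_⟩,
      fun hn => ?_⟩
    · have := (h (3 * i) (by omega)).1 (by omega)
      rwa [e0 _ _ hi, e1] at this
    · have := (h (3 * i + 1) (by omega)).2 (by omega)
      rwa [e1, e2] at this
    · obtain ⟨i, rfl⟩ := Nat.exists_eq_add_of_le' hi0
      have := (h (3 * i + 2) (by omega)).2 (by omega)
      rw [e2] at this
      exact e0 (i + 1) (by omega) hi ▸ this
    · obtain ⟨i, rfl⟩ := Nat.exists_eq_add_of_le' hn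
      have := (h (3 * i + 2) (by omega)).2 (by omega)
      rw [e2] at this
      exact e3 ▸ this

theorem LB_rec (n : ℕ) (hn : 1 ≤ n) :
    LBcount n = LEcount n + ∑ k ∈ Finset.Icc 1 n,
      Nat.choose (3*n+1) (3*k-1) * LBcount (k-1) * LBcount (n-k) := by
  rw [LBcount_eq_card_descentPerms, LEcount_eq_card_descentPerms, card_descentPerms_succ,
    Finset.sum_range_succ', add_comm]
  congr 1
  · have hD : ∀ i, (i + 0 + 1) % 3 = 1 ↔ i % 3 = 0 := by omega
    have h1 : (descentPerms (fun i => i % 3 = 1) 0).card = 1 := by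
      rw [Finset.card_eq_one]
      exact ⟨1, Finset.eq_singleton_iff_unique_mem.2
        ⟨mem_descentPerms.2 fun i h => absurd h (by omega), fun σ _ => Subsingleton.elim _ _⟩⟩
    simp only [hD, h1]
    simp
  · symm
    refine Finset.sum_of_injOn (fun k => 3 * k - 2) ?_ ?_ ?_ ?_
    · intro a ha b hb hab
      simp only [Finset.coe_Icc, Set.mem_Icc] at ha hb hab
      omega
    · intro k hk
      simp only [Finset.coe_Icc, Set.mem_Icc, Finset.coe_range, Set.mem_Iio] at hk ⊢
      omega
    · intro j hj hj'
      simp only [Set.mem_image, Finset.coe_Icc, Set.mem_Icc, Finset.mem_range] at hj hj'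
      rw [if_neg, mul_zero]
      rintro ⟨h, -⟩
      have := h (by omega)
      exact hj' ⟨j / 3 + 1, by omega, by omega⟩
    · intro k hk
      obtain ⟨hk1, hkn⟩ := Finset.mem_Icc.1 hk
      obtain ⟨i, rfl⟩ := Nat.exists_eq_add_of_le' hk1
      have hD : ∀ l, (l + (3 * i + 2) + 1) % 3 = 1 ↔ l % 3 = 1 := by omega
      simp only [show 3 * (i + 1) - 2 + 1 = 3 * i + 2 by omega,
        show 3 * (i + 1) - 1 = 3 * i + 2 by omega, hD]
      rw [if_pos ⟨fun _ => by omega, fun _ => by omega⟩, LBcount_eq_card_descentPerms,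
        LBcount_eq_card_descentPerms, mul_assoc,
        show 3 * n + 1 - (3 * (i + 1) - 2 + 1) = 3 * (n - (i + 1)) + 2 by omega,
        show 3 * (i + 1) - 2 + 1 = 3 * i + 2 by omega, Nat.add_sub_cancel]
end
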